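/- arXiv:2404.02080 — 2 statements merged into one kernel-verified Lean document; each statement's English description precedes it below -/
import Mathlib

section
/- Let v ∈ ℝⁿ be a unit vector such that x_z(0,z̄)v = 0. Then the map g_v(θ) := g(z̄+θv, z̄) is twice differentiable at θ = 0 and g_v'(0) = 0 and g_v''(0) = 0. -/
open scoped InnerProductSpace

noncomputable section

abbrev E (k : ℕ) : Type := EuclideanSpace ℝ (Fin k)


lemma quad_remainder {V : Type*} [NormedAddCommGroup V] [NormedSpace ℝ V] [FiniteDimensional ℝ V]
    (G : V → ℝ) (hG : ContDiff ℝ 2 G) (R : ℝ) :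
    ∃ C, 0 ≤ C ∧ ∀ a ∈ Metric.closedBall (0 : V) R, ∀ b ∈ Metric.closedBall (0 : V) R,
      |G b - G a - fderiv ℝ G a (b - a)| ≤ C * ‖b - a‖ ^ 2 := by
  have hG' : ContDiff ℝ 1 (fderiv ℝ G) := hG.fderiv_right (by norm_num)
  have : ProperSpace V := FiniteDimensional.proper ℝ V
  obtain ⟨K, hK⟩ := hG'.contDiffOn.exists_lipschitzOnWith one_ne_zero
    (convex_closedBall (0 : V) R) (isCompact_closedBall (0 : V) R)
  refine ⟨K, K.2, fun a ha b hb => ?_⟩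
  have hseg : segment ℝ a b ⊆ Metric.closedBall (0 : V) R :=
    (convex_closedBall (0 : V) R).segment_subset ha hb
  have := Convex.norm_image_sub_le_of_norm_hasFDerivWithin_le' (f := G) (f' := fderiv ℝ G)
    (s := segment ℝ a b) (φ := fderiv ℝ G a) (C := K * ‖b - a‖) (x := a) (y := b)
    (fun y hy => ((hG.differentiable (by norm_num)) y).hasFDerivAt.hasFDerivWithinAt)
    (fun y hy => by
      have h1 := hK.dist_le_mul y (hseg hy) a ha
      rw [dist_eq_norm, dist_eq_norm] at h1
      refine h1.trans ?_
      gcongr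
      exact norm_sub_le_of_mem_segment hy)
    (convex_segment a b) (left_mem_segment ℝ a b) (right_mem_segment ℝ a b)
  rw [Real.norm_eq_abs] at this
  refine this.trans (le_of_eq (by ring))

lemma mv_pow {V : Type*} [NormedAddCommGroup V] [NormedSpace ℝ V] (h h' : ℝ → V) (C : ℝ) (j : ℕ)
    (hd : ∀ᶠ θ in nhds (0 : ℝ), HasDerivAt h (h' θ) θ)
    (hb : ∀ᶠ θ in nhds (0 : ℝ), ‖h' θ‖ ≤ C * |θ| ^ j) :
    ∀ᶠ θ in nhds (0 : ℝ), ‖h θ - h 0‖ ≤ C * |θ| ^ (j + 1) := by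
  obtain ⟨r, hr, H⟩ := Metric.eventually_nhds_iff_ball.1 (hd.and hb)
  refine Metric.eventually_nhds_iff_ball.2 ⟨r, hr, fun θ hθ => ?_⟩
  have hC : 0 ≤ C ∨ θ = 0 := by
    by_cases h0 : θ = 0
    · exact Or.inr h0
    · left
      have := (norm_nonneg _).trans (H θ hθ).2
      have h2 : 0 < |θ| ^ j := by positivity
      by_contra hc
      push Not at hc
      nlinarith
  rcases hC with hC | rfl
  · have hs : segment ℝ 0 θ ⊆ Metric.ball 0 r :=
      (convex_ball (0 : ℝ) r).segment_subset (Metric.mem_ball_self hr) hθ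
    have := Convex.norm_image_sub_le_of_norm_hasDerivWithin_le (f := h) (f' := h')
      (s := segment ℝ 0 θ) (C := C * |θ| ^ j) (x := 0) (y := θ)
      (fun y hy => (H y (hs hy)).1.hasDerivWithinAt)
      (fun y hy => by
        refine (H y (hs hy)).2.trans ?_
        have := norm_sub_le_of_mem_segment hy
        simp only [sub_zero, Real.norm_eq_abs] at this
        gcongr)
      (convex_segment _ _) (left_mem_segment ℝ _ _) (right_mem_segment ℝ _ _)
    refine this.trans (le_of_eq ?_)
    rw [sub_zero, Real.norm_eq_abs]; ring
  · simp

/-- final step -/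
lemma second_deriv_zero (g g' : ℝ → ℝ) (a C : ℝ)
    (hd : ∀ᶠ θ in nhds (0 : ℝ), HasDerivAt g (g' θ) θ)
    (hd2 : HasDerivAt g' a 0)
    (hb : ∀ᶠ θ in nhds (0 : ℝ), |g θ - g 0| ≤ C * |θ| ^ 3) : g' 0 = 0 ∧ a = 0 := by
  have hg0 : HasDerivAt g 0 0 := by
    rw [hasDerivAt_iff_isLittleO]
    have h1 : (fun θ : ℝ => g θ - g 0) =O[nhds 0] fun θ : ℝ => θ ^ 3 := by
      refine Asymptotics.IsBigO.of_bound C ?_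
      filter_upwards [hb] with θ h
      simpa [abs_pow] using h
    have h2 : (fun θ : ℝ => θ ^ 3) =o[nhds 0] fun θ : ℝ => θ := by
      simpa using Asymptotics.isLittleO_pow_pow (𝕜 := ℝ) (show 1 < 3 by norm_num)
    simpa using h1.trans_isLittleO h2
  have h00 : g' 0 = 0 := hd.self_of_nhds.unique hg0
  refine ⟨h00, ?_⟩
  by_contra ha
  have hapos : 0 < |a| := abs_pos.2 ha
  have h1 := hasDerivAt_iff_isLittleO.1 hd2
  have h2 := h1.bound (show 0 < |a| / 8 by positivity)
  have h3 := mv_pow (fun θ => g θ - a / 2 * θ ^ 2) (fun θ => g' θ - a * θ) (|a| / 8) 1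
    (by
      filter_upwards [hd] with θ h
      have := h.sub ((hasDerivAt_pow 2 θ).const_mul (a / 2))
      refine this.congr_deriv ?_
      norm_num; ring)
    (by
      filter_upwards [h2] with θ h
      simpa [h00, mul_comm] using h)
  have h4 : ∀ᶠ θ in nhds (0 : ℝ), C * |θ| < |a| / 8 := by
    have : Filter.Tendsto (fun θ : ℝ => C * |θ|) (nhds 0) (nhds (C * |(0 : ℝ)|)) :=
      (continuous_const.mul continuous_abs).tendsto _
    rw [abs_zero, mul_zero] at this
    exact this.eventually_lt_const (by positivity)
  obtain ⟨r, hr, H⟩ := Metric.eventually_nhds_iff_ball.1 (h3.and (hb.and h4))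
  obtain ⟨k1, k2, k3⟩ := H (r / 2) (by simp [abs_of_pos hr]; linarith)
  set θ := r / 2
  have hθ : 0 < θ := by positivity
  rw [abs_of_pos hθ] at *
  simp only [Real.norm_eq_abs] at k1
  have e1 : |a / 2 * θ ^ 2| ≤ |a| / 8 * θ ^ 2 + C * θ ^ 3 := by
    have : a / 2 * θ ^ 2 = (g θ - g 0) - (g θ - a / 2 * θ ^ 2 - (g 0 - a / 2 * 0 ^ 2)) := by ring
    rw [this]
    refine (abs_sub _ _).trans ?_
    norm_num at k1 k2 ⊢
    linarith
  rw [abs_mul, abs_div, abs_of_pos (show (0 : ℝ) < θ ^ 2 by positivity)] at e1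
  norm_num at e1
  have : C * θ ^ 3 ≤ |a| / 8 * θ ^ 2 := by
    have : C * θ ^ 3 = (C * θ) * θ ^ 2 := by ring
    rw [this]; gcongr
  nlinarith [mul_pos hapos (pow_pos hθ 2)]

lemma stationary_contDiff {A W : Type*} [NormedAddCommGroup A] [NormedSpace ℝ A] [CompleteSpace A]
    [NormedAddCommGroup W] [NormedSpace ℝ W] [FiniteDimensional ℝ W]
    (H : A × W → ℝ) (hH : ContDiff ℝ 3 H) (s : A → W) (δ : ℝ) (hδ : 0 < δ)
    (hs : ∀ a, fderiv ℝ (fun ω => H (a, ω)) (s a) = 0)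
    (hc : ∀ a ω c, δ * ‖c‖ ^ 2 ≤ fderiv ℝ (fderiv ℝ (fun ω => H (a, ω))) ω c c) :
    ContDiff ℝ 2 s := by
  have : CompleteSpace W := FiniteDimensional.complete ℝ W
  let G : A × W → (W →L[ℝ] ℝ) := fun q => (fderiv ℝ H q) ∘L (ContinuousLinearMap.inr ℝ A W)
  have hG : ContDiff ℝ 2 G := by
    have : ContDiff ℝ 2 (fderiv ℝ H) := hH.fderiv_right (by norm_num)
    exact this.clm_comp contDiff_const
  have hGe : ∀ a, (fun ω => G (a, ω)) = fderiv ℝ (fun ω => H (a, ω)) := by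
    intro a
    funext ω
    have h1 : HasFDerivAt H (fderiv ℝ H (a, ω)) (a, ω) :=
      (hH.differentiable (by norm_num) (a, ω)).hasFDerivAt
    exact (h1.comp ω (hasFDerivAt_prodMk_right a ω)).fderiv.symm
  have hGd : ∀ a ω, fderiv ℝ G (a, ω) ∘L (ContinuousLinearMap.inr ℝ A W)
      = fderiv ℝ (fderiv ℝ (fun ω => H (a, ω))) ω := by
    intro a ω
    rw [← hGe a]
    have h1 : HasFDerivAt G (fderiv ℝ G (a, ω)) (a, ω) :=
      (hG.differentiable (by norm_num) (a, ω)).hasFDerivAt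
    exact (h1.comp ω (hasFDerivAt_prodMk_right a ω)).fderiv.symm
  have huniq : ∀ a ω, G (a, ω) = 0 → ω = s a := by
    intro a ω h0
    by_contra hne
    set c := ω - s a with hcdef
    have hcne : c ≠ 0 := sub_ne_zero.2 hne
    have hcpos : 0 < ‖c‖ := norm_pos_iff.2 hcne
    have hD : ∀ τ : ℝ, HasDerivAt (fun τ : ℝ => fderiv ℝ (fun ω => H (a, ω)) (s a + τ • c) c)
        (fderiv ℝ (fderiv ℝ (fun ω => H (a, ω))) (s a + τ • c) c c) τ := by
      intro τ
      have hdiff : Differentiable ℝ (fderiv ℝ (fun ω => H (a, ω))) := by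
        rw [← hGe a]
        exact (hG.differentiable (by norm_num)).comp (by fun_prop)
      have h1 := (hdiff (s a + τ • c)).hasFDerivAt
      have h2 : HasDerivAt (fun τ : ℝ => s a + τ • c) c τ := by
        simpa using ((hasDerivAt_id τ).smul_const c).const_add (s a)
      have h3 := h1.comp_hasDerivAt τ h2
      exact (ContinuousLinearMap.apply ℝ ℝ c).hasFDerivAt.comp_hasDerivAt τ h3
    have hmono := strictMono_of_deriv_pos (f := fun τ : ℝ =>
      fderiv ℝ (fun ω => H (a, ω)) (s a + τ • c) c) (fun τ => by
        rw [(hD τ).deriv]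
        have := hc a (s a + τ • c) c
        have : 0 < δ * ‖c‖ ^ 2 := by positivity
        linarith)
    have := hmono (show (0 : ℝ) < 1 by norm_num)
    have e : s a + c = ω := by simp [hcdef]
    simp only [zero_smul, add_zero, one_smul, e, hs a, ← hGe a, h0] at this
    simp at this
  rw [contDiff_iff_contDiffAt]
  intro a
  have hinv : (fderiv ℝ G (a, s a) ∘L (ContinuousLinearMap.inr ℝ A W)).IsInvertible := by
    rw [hGd]
    set B := fderiv ℝ (fderiv ℝ (fun ω => H (a, ω))) (s a) with hB
    have hinj : Function.Injective (B : W →ₗ[ℝ] (W →L[ℝ] ℝ)) := by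
      rw [← LinearMap.ker_eq_bot, LinearMap.ker_eq_bot']
      intro c hc0
      have h1 := hc a (s a) c
      have hc1 : B c = 0 := hc0
      rw [← hB, hc1] at h1
      simp only [zero_apply] at h1
      by_contra hne
      have : 0 < ‖c‖ := norm_pos_iff.2 hne
      have : 0 < δ * ‖c‖ ^ 2 := by positivity
      linarith
    have hfr : Module.finrank ℝ W = Module.finrank ℝ (W →L[ℝ] ℝ) := by
      rw [← (LinearMap.toContinuousLinearMap (𝕜 := ℝ) (E := W) (F' := ℝ)).finrank_eq]
      exact (Subspace.dual_finrank_eq (K := ℝ) (V := W)).symm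
    let e := (LinearMap.linearEquivOfInjective (B : W →ₗ[ℝ] (W →L[ℝ] ℝ)) hinj hfr)
    refine ⟨e.toContinuousLinearEquiv, ?_⟩
    ext c d
    rfl
  have hcd : ContDiffAt ℝ 2 G (a, s a) := hG.contDiffAt
  have h1 := hcd.contDiffAt_implicitFunction two_ne_zero hinv
  refine h1.congr_of_eventuallyEq ?_
  have h2 := hcd.eventually_apply_implicitFunction two_ne_zero hinv
  filter_upwards [h2] with b hb
  symm
  apply huniq
  rw [hb]
  have : G (a, s a) = _ := congrFun (hGe a) (s a)
  rw [this, hs]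

lemma param_deriv (T : ℝ) (hT : 0 < T) (I : Set ℝ) (hI : IsOpen I) (F : ℝ × ℝ → ℝ)
    (hF : ContDiffOn ℝ 1 F (Set.Icc 0 T ×ˢ I)) (θ : ℝ) (hθ : θ ∈ I) :
    HasDerivAt (fun τ => ∫ t in (0 : ℝ)..T, F (t, τ))
      (∫ t in (0 : ℝ)..T, fderivWithin ℝ F (Set.Icc 0 T ×ˢ I) (t, θ) (0, 1)) θ := by
  set S := Set.Icc 0 T ×ˢ I with hS
  have hSu : UniqueDiffOn ℝ S := (uniqueDiffOn_Icc hT).prod hI.uniqueDiffOn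
  obtain ⟨ε, hε, hball⟩ := Metric.isOpen_iff.1 hI θ hθ
  have hcb : Metric.closedBall θ (ε / 2) ⊆ I :=
    (Metric.closedBall_subset_ball (by linarith)).trans hball
  have hcont : ContinuousOn (fun q : ℝ × ℝ => fderivWithin ℝ F S q (0, 1)) S :=
    (hF.continuousOn_fderivWithin hSu le_rfl).clm_apply continuousOn_const
  have hK : IsCompact (Set.Icc 0 T ×ˢ Metric.closedBall θ (ε / 2)) :=
    isCompact_Icc.prod (isCompact_closedBall _ _)
  obtain ⟨C, hC⟩ := hK.exists_bound_of_continuousOn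
    (hcont.mono (Set.prod_mono le_rfl hcb))
  have huI : Set.uIcc 0 T = Set.Icc 0 T := Set.uIcc_of_le hT.le
  have hsl : ∀ τ ∈ I, ∀ G : ℝ × ℝ → ℝ, ContinuousOn G S →
      IntervalIntegrable (fun t => G (t, τ)) MeasureTheory.volume 0 T := by
    intro τ hτ G hG
    apply ContinuousOn.intervalIntegrable
    rw [huI]
    exact hG.comp (by fun_prop) (fun t ht => ⟨ht, hτ⟩)
  refine (intervalIntegral.hasDerivAt_integral_of_dominated_loc_of_deriv_le
    (F := fun τ t => F (t, τ)) (F' := fun τ t => fderivWithin ℝ F S (t, τ) (0, 1))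
    (bound := fun _ => C) (Metric.ball_mem_nhds θ (half_pos hε)) ?_ ?_ ?_ ?_ ?_ ?_).2
  · filter_upwards [hI.mem_nhds hθ] with τ hτ
    have := (hsl τ hτ F hF.continuousOn).aestronglyMeasurable
    rwa [Set.uIoc_of_le hT.le]
  · exact hsl θ hθ F hF.continuousOn
  · have := (hsl θ hθ _ hcont).aestronglyMeasurable
    rwa [Set.uIoc_of_le hT.le]
  · refine Filter.Eventually.of_forall fun t ht τ hτ => ?_
    rw [Set.uIoc_of_le hT.le] at ht
    exact hC (t, τ) ⟨⟨ht.1.le, ht.2⟩, Metric.ball_subset_closedBall hτ⟩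
  · exact intervalIntegrable_const
  · refine Filter.Eventually.of_forall fun t ht τ hτ => ?_
    rw [Set.uIoc_of_le hT.le] at ht
    have hτI : τ ∈ I := hcb (Metric.ball_subset_closedBall hτ)
    have htI : t ∈ Set.Icc 0 T := ⟨ht.1.le, ht.2⟩
    have h1 : HasFDerivWithinAt F (fderivWithin ℝ F S (t, τ)) S (t, τ) :=
      (hF.differentiableOn one_ne_zero (t, τ) ⟨htI, hτI⟩).hasFDerivWithinAt
    have h2 : HasDerivWithinAt (fun τ : ℝ => (t, τ)) ((0 : ℝ), (1 : ℝ)) I τ :=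
      ((hasDerivAt_const τ t).prodMk (hasDerivAt_id τ)).hasDerivWithinAt
    have h3 := h1.comp_hasDerivWithinAt τ h2 (fun σ hσ => ⟨htI, hσ⟩)
    exact h3.hasDerivAt (hI.mem_nhds hτI)

lemma param_deriv_two (T : ℝ) (hT : 0 < T) (I : Set ℝ) (hI : IsOpen I) (F : ℝ × ℝ → ℝ)
    (hF : ContDiffOn ℝ 2 F (Set.Icc 0 T ×ˢ I)) :
    ∃ F1 F2 : ℝ → ℝ, ∀ θ ∈ I, HasDerivAt (fun τ => ∫ t in (0 : ℝ)..T, F (t, τ)) (F1 θ) θ ∧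
      HasDerivAt F1 (F2 θ) θ := by
  have hSu : UniqueDiffOn ℝ (Set.Icc 0 T ×ˢ I) := (uniqueDiffOn_Icc hT).prod hI.uniqueDiffOn
  refine ⟨_, _, fun θ hθ => ⟨param_deriv T hT I hI F (hF.of_le (by norm_num)) θ hθ,
    param_deriv T hT I hI (fun q => fderivWithin ℝ F (Set.Icc 0 T ×ˢ I) q (0, 1)) ?_ θ hθ⟩⟩
  exact (hF.fderivWithin hSu (by norm_num)).clm_apply contDiffOn_const

def Ham {V W : Type*} [NormedAddCommGroup V] [InnerProductSpace ℝ V]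
    (L : V → W → ℝ) (f : V → W → V) (q : (V × V) × W) : ℝ :=
  L q.1.1 q.2 + ⟪q.1.2, f q.1.1 q.2⟫_ℝ

lemma ham_contDiff {V W : Type*} [NormedAddCommGroup V] [InnerProductSpace ℝ V]
    [NormedAddCommGroup W] [NormedSpace ℝ W] (L : V → W → ℝ) (f : V → W → V)
    (hL : ContDiff ℝ 3 (fun q : V × W => L q.1 q.2))
    (hf : ContDiff ℝ 3 (fun q : V × W => f q.1 q.2)) : ContDiff ℝ 3 (Ham L f) := by
  unfold Ham
  have hp : ContDiff ℝ 3 (fun q : (V × V) × W => (q.1.1, q.2)) := by fun_prop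
  have h1 : ContDiff ℝ 3 (fun q : (V × V) × W => L q.1.1 q.2) := hL.comp hp
  have h2 : ContDiff ℝ 3 (fun q : (V × V) × W => f q.1.1 q.2) := hf.comp hp
  have h3 : ContDiff ℝ 3 (fun q : (V × V) × W => q.1.2) := by fun_prop
  exact h1.add (h3.inner ℝ h2)

lemma expansion {V W : Type*} [NormedAddCommGroup V] [InnerProductSpace ℝ V] [CompleteSpace V]
    [NormedAddCommGroup W] [NormedSpace ℝ W] (L : V → W → ℝ) (f : V → W → V)
    (hL : ContDiff ℝ 3 (fun q : V × W => L q.1 q.2))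
    (hf : ContDiff ℝ 3 (fun q : V × W => f q.1 q.2))
    (ψ : V → ℝ) (hψ : ContDiff ℝ 3 ψ) (T : ℝ) (hT : 0 < T)
    (X P Y : ℝ → V) (u w : ℝ → W)
    (hX : ContinuousOn X (Set.Icc 0 T)) (hP : ContinuousOn P (Set.Icc 0 T))
    (hY : ContinuousOn Y (Set.Icc 0 T)) (hu : ContinuousOn u (Set.Icc 0 T))
    (hw : ContinuousOn w (Set.Icc 0 T))
    (hXode : ∀ t ∈ Set.Icc 0 T, HasDerivAt X (f (X t) (u t)) t)
    (hYode : ∀ t ∈ Set.Icc 0 T, HasDerivAt Y (f (Y t) (w t)) t)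
    (hPd : ∀ t ∈ Set.Ioo 0 T, DifferentiableAt ℝ P t)
    (hPode : ∀ t ∈ Set.Icc 0 T, ∀ h : V, HasDerivAt (fun s => ⟪P s, h⟫_ℝ)
          (-⟪P t, fderiv ℝ (fun y => f y (u t)) (X t) h⟫_ℝ
            - fderiv ℝ (fun y => L y (u t)) (X t) h) t)
    (hPT : P T = gradient ψ (X T))
    (hstat : ∀ t ∈ Set.Icc 0 T, fderiv ℝ (fun ω => Ham L f ((X t, P t), ω)) (u t) = 0)
    (κ κ' : ℝ)
    (hκ : ∀ t ∈ Set.Icc 0 T, |Ham L f ((Y t, P t), w t) - Ham L f ((X t, P t), u t)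
      - fderiv ℝ (Ham L f) ((X t, P t), u t) (((Y t, P t), w t) - ((X t, P t), u t))| ≤ κ)
    (hκ' : |ψ (Y T) - ψ (X T) - fderiv ℝ ψ (X T) (Y T - X T)| ≤ κ') :
    |((∫ t in (0 : ℝ)..T, L (Y t) (w t)) + ψ (Y T))
      - ((∫ t in (0 : ℝ)..T, L (X t) (u t)) + ψ (X T)) - ⟪P 0, Y 0 - X 0⟫_ℝ| ≤ κ * T + κ' := by
  have hH := ham_contDiff L f hL hf
  have huI : Set.uIcc 0 T = Set.Icc 0 T := Set.uIcc_of_le hT.le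
  let R : ℝ → ℝ := fun t => Ham L f ((Y t, P t), w t) - Ham L f ((X t, P t), u t)
      - fderiv ℝ (Ham L f) ((X t, P t), u t) (((Y t, P t), w t) - ((X t, P t), u t))
  have ha : ContinuousOn (fun t => ((X t, P t), u t)) (Set.Icc 0 T) := (hX.prodMk hP).prodMk hu
  have hb : ContinuousOn (fun t => ((Y t, P t), w t)) (Set.Icc 0 T) := (hY.prodMk hP).prodMk hw
  have hRc : ContinuousOn R (Set.Icc 0 T) := by
    refine ((hH.continuous.comp_continuousOn hb).sub (hH.continuous.comp_continuousOn ha)).sub ?_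
    exact ((hH.continuous_fderiv (by norm_num)).comp_continuousOn ha).clm_apply (hb.sub ha)
  have hLY : ContinuousOn (fun t => L (Y t) (w t)) (Set.Icc 0 T) :=
    hL.continuous.comp_continuousOn (hY.prodMk hw)
  have hLX : ContinuousOn (fun t => L (X t) (u t)) (Set.Icc 0 T) :=
    hL.continuous.comp_continuousOn (hX.prodMk hu)
  have hii : ∀ G : ℝ → ℝ, ContinuousOn G (Set.Icc 0 T) →
      IntervalIntegrable G MeasureTheory.volume 0 T := by
    intro G hG
    apply ContinuousOn.intervalIntegrable
    rwa [huI]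
  have hder : ∀ t ∈ Set.Ioo 0 T, HasDerivAt (fun s => ⟪P s, Y s - X s⟫_ℝ)
      (R t - (L (Y t) (w t) - L (X t) (u t))) t := by
    intro t ht
    have ht' := Set.Ioo_subset_Icc_self ht
    have h1 := (hPd t ht).hasDerivAt
    have h2 := (hYode t ht').sub (hXode t ht')
    have h3 := h1.inner ℝ h2
    refine h3.congr_deriv ?_
    have h4 : ⟪deriv P t, Y t - X t⟫_ℝ = -⟪P t, fderiv ℝ (fun y => f y (u t)) (X t) (Y t - X t)⟫_ℝ
            - fderiv ℝ (fun y => L y (u t)) (X t) (Y t - X t) := by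
      have := h1.inner ℝ (hasDerivAt_const t (Y t - X t))
      have := this.unique (hPode t ht' _)
      simpa using this
    have hHd : HasFDerivAt (Ham L f) (fderiv ℝ (Ham L f) ((X t, P t), u t)) ((X t, P t), u t) :=
      (hH.differentiable (by norm_num) _).hasFDerivAt
    have h5 : fderiv ℝ (Ham L f) ((X t, P t), u t) ((0, 0), w t - u t) = 0 := by
      have := hHd.comp (u t) (hasFDerivAt_prodMk_right (X t, P t) (u t))
      have h6 := this.fderiv
      have h7 := hstat t ht'
      have h8 := congrArg (fun A => A (w t - u t)) (h6.symm.trans h7)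
      have h9 : fderiv ℝ (Ham L f) ((X t, P t), u t) ((0 : V × V), w t - u t) = 0 := by
        simpa using h8
      exact h9
    have h6 : fderiv ℝ (Ham L f) ((X t, P t), u t) ((Y t - X t, 0), 0)
        = fderiv ℝ (fun y => L y (u t)) (X t) (Y t - X t)
          + ⟪P t, fderiv ℝ (fun y => f y (u t)) (X t) (Y t - X t)⟫_ℝ := by
      have e1 : HasFDerivAt (fun y : V => ((y, P t), u t))
          ((ContinuousLinearMap.inl ℝ (V × V) W) ∘L (ContinuousLinearMap.inl ℝ V V)) (X t) :=
        HasFDerivAt.comp (g := fun r : V × V => (r, u t)) (f := fun y : V => (y, P t)) (X t)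
          (hasFDerivAt_prodMk_left (X t, P t) (u t)) (hasFDerivAt_prodMk_left (X t) (P t))
      have e2 := hHd.comp (X t) e1
      have d1 : DifferentiableAt ℝ (fun y => L y (u t)) (X t) :=
        DifferentiableAt.comp (g := fun q : V × W => L q.1 q.2) (f := fun y : V => (y, u t)) (X t)
          ((hL.differentiable (by norm_num)) (X t, u t))
          (hasFDerivAt_prodMk_left (X t) (u t)).differentiableAt
      have d2 : DifferentiableAt ℝ (fun y => f y (u t)) (X t) :=
        DifferentiableAt.comp (g := fun q : V × W => f q.1 q.2) (f := fun y : V => (y, u t)) (X t)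
          ((hf.differentiable (by norm_num)) (X t, u t))
          (hasFDerivAt_prodMk_left (X t) (u t)).differentiableAt
      have e3 := d1.hasFDerivAt.add ((hasFDerivAt_const (P t) (X t)).inner ℝ d2.hasFDerivAt)
      have e4 := e2.unique e3
      have := congrArg (fun A => A (Y t - X t)) e4
      simpa [real_inner_comm] using this
    have h7 : fderiv ℝ (Ham L f) ((X t, P t), u t) (((Y t, P t), w t) - ((X t, P t), u t))
        = fderiv ℝ (fun y => L y (u t)) (X t) (Y t - X t)
          + ⟪P t, fderiv ℝ (fun y => f y (u t)) (X t) (Y t - X t)⟫_ℝ := by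
      have : (((Y t, P t), w t) - ((X t, P t), u t))
        = ((Y t - X t, (0 : V)), (0 : W)) + ((0, 0), w t - u t) := by simp
      rw [this, map_add, h5, h6, add_zero]
    simp only [R, h7, h4, Pi.sub_apply, Ham, inner_sub_right]
    ring
  have hFTC := intervalIntegral.integral_eq_sub_of_hasDerivAt_of_le hT.le
    (f := fun s => ⟪P s, Y s - X s⟫_ℝ) (hP.inner (hY.sub hX)) hder
    ((hii _ hRc).sub ((hii _ hLY).sub (hii _ hLX)))
  rw [intervalIntegral.integral_sub (hii _ hRc) ((hii _ hLY).sub (hii _ hLX)),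
    intervalIntegral.integral_sub (hii _ hLY) (hii _ hLX)] at hFTC
  have hR : |∫ t in (0 : ℝ)..T, R t| ≤ κ * T := by
    have := intervalIntegral.norm_integral_le_of_norm_le_const (a := 0) (b := T) (f := R) (C := κ)
      (fun t ht => by
        rw [Set.uIoc_of_le hT.le] at ht
        exact hκ t ⟨ht.1.le, ht.2⟩)
    simpa [abs_of_pos hT] using this
  have hPTe : ⟪P T, Y T - X T⟫_ℝ = fderiv ℝ ψ (X T) (Y T - X T) := by
    rw [hPT, gradient, InnerProductSpace.toDual_symm_apply]
  rw [hPTe] at hFTC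
  have : ((∫ t in (0 : ℝ)..T, L (Y t) (w t)) + ψ (Y T))
      - ((∫ t in (0 : ℝ)..T, L (X t) (u t)) + ψ (X T)) - ⟪P 0, Y 0 - X 0⟫_ℝ
      = (∫ t in (0 : ℝ)..T, R t) + (ψ (Y T) - ψ (X T) - fderiv ℝ ψ (X T) (Y T - X T)) := by
    linarith
  rw [this]
  exact (abs_add_le _ _).trans (add_le_add hR hκ')

lemma core {V W : Type*} [NormedAddCommGroup V] [InnerProductSpace ℝ V] [FiniteDimensional ℝ V]
    [NormedAddCommGroup W] [NormedSpace ℝ W] [FiniteDimensional ℝ W] (L : V → W → ℝ) (f : V → W → V)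
    (hL : ContDiff ℝ 3 (fun q : V × W => L q.1 q.2))
    (hf : ContDiff ℝ 3 (fun q : V × W => f q.1 q.2))
    (ψ : V → ℝ) (hψ : ContDiff ℝ 3 ψ) (T : ℝ) (hT : 0 < T)
    (I : Set ℝ) (hI : IsOpen I) (h0I : (0 : ℝ) ∈ I)
    (X P Y : ℝ → ℝ → V) (u : ℝ → ℝ → W)
    (hX : ContDiffOn ℝ 2 (fun q : ℝ × ℝ => X q.1 q.2) (Set.Icc 0 T ×ˢ I))
    (hP : ContDiffOn ℝ 2 (fun q : ℝ × ℝ => P q.1 q.2) (Set.Icc 0 T ×ˢ I))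
    (hY : ContDiffOn ℝ 2 (fun q : ℝ × ℝ => Y q.1 q.2) (Set.Icc 0 T ×ˢ I))
    (hu : ContDiffOn ℝ 2 (fun q : ℝ × ℝ => u q.1 q.2) (Set.Icc 0 T ×ˢ I))
    (hXode : ∀ θ ∈ I, ∀ t ∈ Set.Icc 0 T, HasDerivAt (fun s => X s θ) (f (X t θ) (u t θ)) t)
    (hYode : ∀ θ ∈ I, ∀ t ∈ Set.Icc 0 T, HasDerivAt (fun s => Y s θ) (f (Y t θ) (u t θ)) t)
    (hPode : ∀ θ ∈ I, ∀ t ∈ Set.Icc 0 T, ∀ h : V, HasDerivAt (fun s => ⟪P s θ, h⟫_ℝ)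
          (-⟪P t θ, fderiv ℝ (fun y => f y (u t θ)) (X t θ) h⟫_ℝ
            - fderiv ℝ (fun y => L y (u t θ)) (X t θ) h) t)
    (hPT : ∀ θ ∈ I, P T θ = gradient ψ (X T θ))
    (hstat : ∀ θ ∈ I, ∀ t ∈ Set.Icc 0 T,
      fderiv ℝ (fun ω => Ham L f ((X t θ, P t θ), ω)) (u t θ) = 0)
    (hY0 : ∀ θ ∈ I, Y 0 θ = X 0 0)
    (hker : deriv (X 0) 0 = 0) :
    ∃ G1 : ℝ → ℝ, (∀ᶠ θ in nhds (0 : ℝ),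
      HasDerivAt (fun θ => (∫ t in (0 : ℝ)..T, L (Y t θ) (u t θ)) + ψ (Y T θ)) (G1 θ) θ)
      ∧ HasDerivAt G1 0 0 ∧ G1 0 = 0 := by
  have : CompleteSpace V := FiniteDimensional.complete ℝ V
  have : ProperSpace V := FiniteDimensional.proper ℝ V
  have : ProperSpace W := FiniteDimensional.proper ℝ W
  have hH := ham_contDiff L f hL hf
  -- slices
  have slt : ∀ {Z : Type _} [NormedAddCommGroup Z] [NormedSpace ℝ Z] (A : ℝ → ℝ → Z),
      ContDiffOn ℝ 2 (fun q : ℝ × ℝ => A q.1 q.2) (Set.Icc 0 T ×ˢ I) →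
      ∀ θ ∈ I, ContDiffOn ℝ 2 (fun t => A t θ) (Set.Icc 0 T) := by
    intro Z _ _ A hA θ hθ
    exact hA.comp (f := fun t : ℝ => (t, θ)) (by fun_prop) (fun t ht => ⟨ht, hθ⟩)
  have slw : ∀ θ ∈ I, ContDiffOn ℝ 2 (fun t => u t θ) (Set.Icc 0 T) := by
    intro θ hθ
    exact hu.comp (f := fun t : ℝ => (t, θ)) (by fun_prop) (fun t ht => ⟨ht, hθ⟩)
  have slθ : ∀ (A : ℝ → ℝ → V),
      ContDiffOn ℝ 2 (fun q : ℝ × ℝ => A q.1 q.2) (Set.Icc 0 T ×ˢ I) →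
      ∀ t ∈ Set.Icc 0 T, ContDiffOn ℝ 2 (A t) I := by
    intro A hA t ht
    exact hA.comp (f := fun θ : ℝ => (t, θ)) (by fun_prop) (fun θ hθ => ⟨ht, hθ⟩)
  have h0T : (0 : ℝ) ∈ Set.Icc 0 T := ⟨le_rfl, hT.le⟩
  have hTT : T ∈ Set.Icc 0 T := ⟨hT.le, le_rfl⟩
  obtain ⟨ε, hε, hball⟩ := Metric.nhds_basis_closedBall.mem_iff.1 (hI.mem_nhds h0I)
  set B := Metric.closedBall (0 : ℝ) ε with hB
  have h0B : (0 : ℝ) ∈ B := Metric.mem_closedBall_self hε.le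
  have hBn : B ∈ nhds (0 : ℝ) := Metric.closedBall_mem_nhds _ hε
  set K := Set.Icc 0 T ×ˢ B with hKdef
  have hKc : IsCompact K := isCompact_Icc.prod (isCompact_closedBall _ _)
  have hKv : Convex ℝ K := (convex_Icc _ _).prod (convex_closedBall _ _)
  have hKS : K ⊆ Set.Icc 0 T ×ˢ I := Set.prod_mono le_rfl hball
  obtain ⟨ΛX, hΛX⟩ := (hX.mono hKS).exists_lipschitzOnWith two_ne_zero hKv hKc
  obtain ⟨Λu, hΛu⟩ := (hu.mono hKS).exists_lipschitzOnWith two_ne_zero hKv hKc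
  obtain ⟨RX, hRX⟩ := hKc.exists_bound_of_continuousOn (hX.mono hKS).continuousOn
  obtain ⟨RP, hRP⟩ := hKc.exists_bound_of_continuousOn (hP.mono hKS).continuousOn
  obtain ⟨RY, hRY⟩ := hKc.exists_bound_of_continuousOn (hY.mono hKS).continuousOn
  obtain ⟨Ru, hRu⟩ := hKc.exists_bound_of_continuousOn (hu.mono hKS).continuousOn
  obtain ⟨R, hR1, hR2, hR3, hR4⟩ : ∃ R, RX ≤ R ∧ RP ≤ R ∧ RY ≤ R ∧ Ru ≤ R :=
    ⟨max (max RX RP) (max RY Ru), by simp, by simp, by simp, by simp⟩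
  have bX : ∀ t ∈ Set.Icc 0 T, ∀ θ ∈ B, ‖X t θ‖ ≤ R := fun t ht θ hθ =>
    (hRX (t, θ) ⟨ht, hθ⟩).trans hR1
  have bP : ∀ t ∈ Set.Icc 0 T, ∀ θ ∈ B, ‖P t θ‖ ≤ R := fun t ht θ hθ =>
    (hRP (t, θ) ⟨ht, hθ⟩).trans hR2
  have bY : ∀ t ∈ Set.Icc 0 T, ∀ θ ∈ B, ‖Y t θ‖ ≤ R := fun t ht θ hθ =>
    (hRY (t, θ) ⟨ht, hθ⟩).trans hR3
  have bu : ∀ t ∈ Set.Icc 0 T, ∀ θ ∈ B, ‖u t θ‖ ≤ R := fun t ht θ hθ =>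
    (hRu (t, θ) ⟨ht, hθ⟩).trans hR4
  obtain ⟨C1, hC1, hrem1⟩ := quad_remainder (Ham L f) (hH.of_le (by norm_num)) R
  obtain ⟨C2, hC2, hrem2⟩ := quad_remainder ψ (hψ.of_le (by norm_num)) R
  -- general expansion
  have hexp : ∀ θ ∈ B, ∀ (Y' : ℝ → V) (w' : ℝ → W) (d : ℝ),
      ContinuousOn Y' (Set.Icc 0 T) → ContinuousOn w' (Set.Icc 0 T) →
      (∀ t ∈ Set.Icc 0 T, HasDerivAt Y' (f (Y' t) (w' t)) t) →
      (∀ t ∈ Set.Icc 0 T, ‖Y' t‖ ≤ R ∧ ‖w' t‖ ≤ R ∧ ‖Y' t - X t θ‖ ≤ d ∧ ‖w' t - u t θ‖ ≤ d) →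
      |((∫ t in (0 : ℝ)..T, L (Y' t) (w' t)) + ψ (Y' T))
        - ((∫ t in (0 : ℝ)..T, L (X t θ) (u t θ)) + ψ (X T θ)) - ⟪P 0 θ, Y' 0 - X 0 θ⟫_ℝ|
        ≤ (C1 * T + C2) * d ^ 2 := by
    intro θ hθ Y' w' d hY' hw' hode hbd
    have hθI := hball hθ
    have hd : 0 ≤ d := (norm_nonneg _).trans (hbd 0 h0T).2.2.1
    have := expansion L f hL hf ψ hψ T hT (fun t => X t θ) (fun t => P t θ) Y' (fun t => u t θ) w'
      (slt X hX θ hθI).continuousOn (slt P hP θ hθI).continuousOn hY'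
      (slw θ hθI).continuousOn hw' (hXode θ hθI) hode
      (fun t ht => ((slt P hP θ hθI).differentiableOn two_ne_zero t
        (Set.Ioo_subset_Icc_self ht)).differentiableAt (Icc_mem_nhds ht.1 ht.2))
      (hPode θ hθI) (hPT θ hθI) (hstat θ hθI) (C1 * d ^ 2) (C2 * d ^ 2)
      (by
        intro t ht
        obtain ⟨q1, q2, q3, q4⟩ := hbd t ht
        refine (hrem1 _ ?_ _ ?_).trans ?_
        · rw [mem_closedBall_zero_iff]
          exact norm_prod_le_iff.2 ⟨norm_prod_le_iff.2 ⟨bX t ht θ hθ, bP t ht θ hθ⟩, bu t ht θ hθ⟩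
        · rw [mem_closedBall_zero_iff]
          exact norm_prod_le_iff.2 ⟨norm_prod_le_iff.2 ⟨q1, bP t ht θ hθ⟩, q2⟩
        · gcongr
          exact norm_prod_le_iff.2 ⟨norm_prod_le_iff.2 ⟨q3, by simpa using hd⟩, q4⟩)
      (by
        obtain ⟨q1, q2, q3, q4⟩ := hbd T hTT
        refine (hrem2 _ ?_ _ ?_).trans ?_
        · rw [mem_closedBall_zero_iff]
          exact bX T hTT θ hθ
        · rw [mem_closedBall_zero_iff]
          exact q1
        · gcongr)
    refine this.trans (le_of_eq (by ring))
  set J : ℝ → ℝ := fun θ => (∫ t in (0 : ℝ)..T, L (X t θ) (u t θ)) + ψ (X T θ) with hJ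
  set G : ℝ → ℝ := fun θ => (∫ t in (0 : ℝ)..T, L (Y t θ) (u t θ)) + ψ (Y T θ) with hG
  -- (a)
  obtain ⟨Λ, hΛ1, hΛ2⟩ : ∃ Λ : ℝ, (ΛX : ℝ) ≤ Λ ∧ (Λu : ℝ) ≤ Λ :=
    ⟨max ΛX Λu, le_max_left _ _, le_max_right _ _⟩
  have ha : ∀ θ ∈ B, ∀ θ' ∈ B, |J θ' - J θ - ⟪P 0 θ, X 0 θ' - X 0 θ⟫_ℝ|
      ≤ (C1 * T + C2) * (Λ * |θ' - θ|) ^ 2 := by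
    intro θ hθ θ' hθ'
    have hθI' := hball hθ'
    refine hexp θ hθ (fun t => X t θ') (fun t => u t θ') _ (slt X hX θ' hθI').continuousOn
      (slw θ' hθI').continuousOn (hXode θ' hθI') (fun t ht => ⟨bX t ht θ' hθ', bu t ht θ' hθ', ?_, ?_⟩)
    · have := hΛX.dist_le_mul (t, θ') ⟨ht, hθ'⟩ (t, θ) ⟨ht, hθ⟩
      rw [dist_eq_norm, Prod.dist_eq, dist_self, max_eq_right dist_nonneg, Real.dist_eq] at this
      exact this.trans (by gcongr)
    · have := hΛu.dist_le_mul (t, θ') ⟨ht, hθ'⟩ (t, θ) ⟨ht, hθ⟩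
      rw [dist_eq_norm, Prod.dist_eq, dist_self, max_eq_right dist_nonneg, Real.dist_eq] at this
      exact this.trans (by gcongr)
  -- derivatives of the initial data
  have dX : ∀ θ ∈ I, HasDerivAt (X 0) (deriv (X 0) θ) θ := fun θ hθ =>
    (((slθ X hX 0 h0T).differentiableOn two_ne_zero θ hθ).differentiableAt
      (hI.mem_nhds hθ)).hasDerivAt
  have dP : ∀ θ ∈ I, HasDerivAt (P 0) (deriv (P 0) θ) θ := fun θ hθ =>
    (((slθ P hP 0 h0T).differentiableOn two_ne_zero θ hθ).differentiableAt
      (hI.mem_nhds hθ)).hasDerivAt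
  have ddX : ContDiffOn ℝ 1 (deriv (X 0)) I := (slθ X hX 0 h0T).deriv_of_isOpen hI (by norm_num)
  have ddP : ContDiffOn ℝ 1 (deriv (P 0)) I := (slθ P hP 0 h0T).deriv_of_isOpen hI (by norm_num)
  -- X 0 θ - X 0 0 = O(θ^2)
  obtain ⟨C3, hX2⟩ : ∃ C, ∀ᶠ θ in nhds (0 : ℝ), ‖X 0 θ - X 0 0‖ ≤ C * |θ| ^ 2 := by
    have h1 := ((ddX.differentiableOn one_ne_zero 0 h0I).differentiableAt
      (hI.mem_nhds h0I)).hasDerivAt.isBigO_sub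
    obtain ⟨C, hC⟩ := h1.bound
    refine ⟨C, mv_pow (X 0) (deriv (X 0)) C 1 ?_ ?_⟩
    · filter_upwards [hI.mem_nhds h0I] with θ hθ using dX θ hθ
    · filter_upwards [hC] with θ hθ
      simpa [hker] using hθ
  -- Gronwall
  obtain ⟨Kf, hKf⟩ := (hf.contDiffOn (s := Metric.closedBall (0 : V × W) R)).exists_lipschitzOnWith
    three_ne_zero (convex_closedBall _ _) (isCompact_closedBall _ _)
  have hgron : ∀ θ ∈ B, ∀ t ∈ Set.Icc 0 T,
      ‖Y t θ - X t θ‖ ≤ ‖X 0 θ - X 0 0‖ * Real.exp (Kf * T) := by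
    intro θ hθ t ht
    have hθI := hball hθ
    have := dist_le_of_trajectories_ODE_of_mem (v := fun t y => f y (u t θ)) (K := Kf)
      (s := fun _ => Metric.closedBall (0 : V) R) (a := 0) (b := T)
      (f := fun t => Y t θ) (g := fun t => X t θ) (δ := ‖X 0 θ - X 0 0‖)
      (fun t ht => LipschitzOnWith.of_dist_le_mul fun y hy y' hy' => by
        rw [mem_closedBall_zero_iff] at hy hy'
        have ht' := Set.Ico_subset_Icc_self ht
        have := hKf.dist_le_mul (y, u t θ)
          (by rw [mem_closedBall_zero_iff]; exact norm_prod_le_iff.2 ⟨hy, bu t ht' θ hθ⟩)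
          (y', u t θ)
          (by rw [mem_closedBall_zero_iff]; exact norm_prod_le_iff.2 ⟨hy', bu t ht' θ hθ⟩)
        simpa [Prod.dist_eq] using this)
      (slt Y hY θ hθI).continuousOn
      (fun t ht => (hYode θ hθI t (Set.Ico_subset_Icc_self ht)).hasDerivWithinAt)
      (fun t ht => by
        rw [mem_closedBall_zero_iff]; exact bY t (Set.Ico_subset_Icc_self ht) θ hθ)
      (slt X hX θ hθI).continuousOn
      (fun t ht => (hXode θ hθI t (Set.Ico_subset_Icc_self ht)).hasDerivWithinAt)
      (fun t ht => by
        rw [mem_closedBall_zero_iff]; exact bX t (Set.Ico_subset_Icc_self ht) θ hθ)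
      (by rw [hY0 θ hθI, dist_eq_norm, norm_sub_rev]) t ht
    rw [dist_eq_norm] at this
    refine this.trans ?_
    gcongr
    linarith [ht.2]
  -- (c)
  set κ := (C1 * T + C2) with hκ
  have hκ0 : 0 ≤ κ := by positivity
  have hc : ∀ θ ∈ B, |G θ - J θ - ⟪P 0 θ, X 0 0 - X 0 θ⟫_ℝ|
      ≤ κ * (‖X 0 θ - X 0 0‖ * Real.exp (Kf * T)) ^ 2 := by
    intro θ hθ
    have hθI := hball hθ
    have := hexp θ hθ (fun t => Y t θ) (fun t => u t θ) _ (slt Y hY θ hθI).continuousOn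
      (slw θ hθI).continuousOn (hYode θ hθI)
      (fun t ht => ⟨bY t ht θ hθ, bu t ht θ hθ, hgron θ hθ t ht, by simp; positivity⟩)
    simp only [hY0 θ hθI] at this
    exact this
  -- (d)
  have hJd : ∀ᶠ θ in nhds (0 : ℝ), HasDerivAt J (⟪P 0 θ, deriv (X 0) θ⟫_ℝ) θ := by
    filter_upwards [Metric.ball_mem_nhds (0 : ℝ) hε] with θ hθ
    have hθB : θ ∈ B := Metric.ball_subset_closedBall hθ
    have hBθ : B ∈ nhds θ :=
      Filter.mem_of_superset (Metric.isOpen_ball.mem_nhds hθ) Metric.ball_subset_closedBall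
    have h1 : HasDerivAt (fun θ' => J θ' - ⟪P 0 θ, X 0 θ'⟫_ℝ) 0 θ := by
      rw [hasDerivAt_iff_isLittleO]
      have h2 : (fun θ' : ℝ => J θ' - J θ - ⟪P 0 θ, X 0 θ' - X 0 θ⟫_ℝ)
          =O[nhds θ] fun θ' => (θ' - θ) ^ 2 := by
        refine Asymptotics.IsBigO.of_bound (κ * Λ ^ 2) ?_
        filter_upwards [hBθ] with θ' hθ'
        refine (ha θ hθB θ' hθ').trans (le_of_eq ?_)
        rw [norm_pow, Real.norm_eq_abs]; ring
      have h3 : (fun θ' : ℝ => (θ' - θ) ^ 2) =o[nhds θ] fun θ' : ℝ => θ' - θ :=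
        by simpa using Asymptotics.isLittleO_pow_sub_sub θ (m := 2) (by norm_num)
      refine (h2.trans_isLittleO h3).congr_left fun θ' => ?_
      simp only [inner_sub_right, smul_zero]; ring
    have h2 := h1.add ((hasDerivAt_const θ (P 0 θ)).inner ℝ (dX θ (hball hθB)))
    refine (h2.congr_deriv ?_).congr_of_eventuallyEq ?_
    · simp
    · filter_upwards with θ'
      simp
  set k : ℝ → ℝ := fun θ => J θ + ⟪P 0 θ, X 0 0 - X 0 θ⟫_ℝ with hk
  have hkd : ∀ᶠ θ in nhds (0 : ℝ), HasDerivAt k (⟪deriv (P 0) θ, X 0 0 - X 0 θ⟫_ℝ) θ := by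
    filter_upwards [hJd, hI.mem_nhds h0I] with θ h1 hθ
    refine (h1.add ((dP θ hθ).inner ℝ ((dX θ hθ).const_sub (X 0 0)))).congr_deriv ?_
    simp
  have hPb : ∀ᶠ θ in nhds (0 : ℝ), ‖deriv (P 0) θ‖ ≤ ‖deriv (P 0) 0‖ + 1 := by
    have : ContinuousAt (deriv (P 0)) 0 := ddP.continuousOn.continuousAt (hI.mem_nhds h0I)
    filter_upwards [this.norm.eventually_lt continuousAt_const
      (show ‖deriv (P 0) 0‖ < ‖deriv (P 0) 0‖ + 1 by linarith)] with θ h using h.le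
  set M := ‖deriv (P 0) 0‖ + 1 with hM
  have hkb := mv_pow k _ (M * C3) 2 hkd (by
    filter_upwards [hPb, hX2] with θ h1 h2
    refine (norm_inner_le_norm _ _).trans ?_
    rw [norm_sub_rev, mul_assoc]
    gcongr)
  have hG3 : ∀ᶠ θ in nhds (0 : ℝ),
      |G θ - G 0| ≤ (M * C3 + κ * (C3 * Real.exp (Kf * T)) ^ 2) * |θ| ^ 3 := by
    have h1 : ∀ᶠ θ in nhds (0 : ℝ), |θ| ≤ 1 := by
      filter_upwards [Metric.closedBall_mem_nhds (0 : ℝ) one_pos] with θ hθ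
      simpa using hθ
    filter_upwards [hkb, hBn, hX2, h1] with θ e1 e2 e3 e4
    have c0 := hc 0 h0B
    have c1 := hc θ e2
    have c0' : G 0 = k 0 := by
      simp at c0
      simp only [hk, sub_self, inner_zero_right]; linarith
    have c1' : |G θ - k θ| ≤ κ * (C3 * Real.exp (Kf * T)) ^ 2 * |θ| ^ 3 := by
      have : G θ - k θ = G θ - J θ - ⟪P 0 θ, X 0 0 - X 0 θ⟫_ℝ := by simp only [hk]; ring
      rw [this]
      refine c1.trans ?_
      calc κ * (‖X 0 θ - X 0 0‖ * Real.exp (Kf * T)) ^ 2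
          ≤ κ * ((C3 * |θ| ^ 2) * Real.exp (Kf * T)) ^ 2 := by gcongr
        _ = κ * (C3 * Real.exp (Kf * T)) ^ 2 * |θ| ^ 3 * |θ| := by ring
        _ ≤ κ * (C3 * Real.exp (Kf * T)) ^ 2 * |θ| ^ 3 * 1 := by gcongr
        _ = _ := by ring
    have : G θ - G 0 = (G θ - k θ) + (k θ - k 0) := by rw [c0']; ring
    rw [this]
    refine (abs_add_le _ _).trans ?_
    rw [Real.norm_eq_abs] at e1
    norm_num at e1
    linarith
  -- regularity of G
  have hF : ContDiffOn ℝ 2 (fun q : ℝ × ℝ => L (Y q.1 q.2) (u q.1 q.2)) (Set.Icc 0 T ×ˢ I) :=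
    (hL.of_le (by norm_num)).comp_contDiffOn (hY.prodMk hu)
  obtain ⟨F1, F2, hF12⟩ := param_deriv_two T hT I hI _ hF
  have hψY : ContDiffOn ℝ 2 (fun θ => ψ (Y T θ)) I :=
    (hψ.of_le (by norm_num)).comp_contDiffOn (slθ Y hY T hTT)
  have hψ' : ContDiffOn ℝ 1 (deriv (fun θ => ψ (Y T θ))) I := hψY.deriv_of_isOpen hI (by norm_num)
  have hG1 : ∀ᶠ θ in nhds (0 : ℝ),
      HasDerivAt G (F1 θ + deriv (fun θ => ψ (Y T θ)) θ) θ := by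
    filter_upwards [hI.mem_nhds h0I] with θ hθ
    exact (hF12 θ hθ).1.add ((hψY.differentiableOn two_ne_zero θ hθ).differentiableAt
      (hI.mem_nhds hθ)).hasDerivAt
  have hG2 : HasDerivAt (fun θ => F1 θ + deriv (fun θ => ψ (Y T θ)) θ)
      (F2 0 + deriv (deriv (fun θ => ψ (Y T θ))) 0) 0 :=
    (hF12 0 h0I).2.add ((hψ'.differentiableOn one_ne_zero 0 h0I).differentiableAt
      (hI.mem_nhds h0I)).hasDerivAt
  obtain ⟨r1, r2⟩ := second_deriv_zero G _ _ _ hG1 hG2 hG3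
  rw [r2] at hG2
  exact ⟨_, hG1, hG2, r1⟩

/-- Lemma 2.1 of the paper: if `v` is a unit vector with `x_z(0,z̄) v = 0`, then
the map `θ ↦ g(z̄ + θ v, z̄)` is twice differentiable at `θ = 0` and its first
and second derivatives vanish there. -/
theorem g_first_two_derivs_vanish
    (n m : ℕ) (hn : 1 ≤ n) (hm : 1 ≤ m) (T : ℝ) (hT : 0 < T)
    -- the control-linear dynamics
    (f0 : E n → E n) (fi : Fin m → E n → E n)
    (hf0 : ContDiff ℝ 3 f0) (hfi : ∀ i, ContDiff ℝ 3 (fi i))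
    (c1 : ℝ) (hc1 : 0 < c1)
    (hgrowth0 : ∀ y : E n, ‖f0 y‖ ≤ c1 * (‖y‖ + 1))
    (hgrowth : ∀ i, ∀ y : E n, ‖fi i y‖ ≤ c1 * (‖y‖ + 1))
    (f : E n → E m → E n)
    (hfdef : ∀ y ω, f y ω = f0 y + ∑ i, ω i • fi i y)
    -- the running cost, three times continuously differentiable, uniformly convex in `u`
    (L : E n → E m → ℝ)
    (hL : ContDiff ℝ 3 (fun q : E n × E m => L q.1 q.2))
    (δL : ℝ) (hδL : 0 < δL)
    (hconv : ∀ y ω, ∀ c : E m,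
      δL * ‖c‖ ^ 2 ≤ iteratedFDeriv ℝ 2 (fun ω' => L y ω') ω ![c, c])
    -- `ustar y q` is the pointwise minimizer of `ω ↦ L y ω + ⟪q, f y ω⟫`
    (ustar : E n → E n → E m)
    (hustar : ∀ y q : E n, ∀ ω : E m,
      L y (ustar y q) + ⟪q, f y (ustar y q)⟫_ℝ ≤ L y ω + ⟪q, f y ω⟫_ℝ)
    -- the terminal cost
    (ψ : E n → ℝ) (hψ : ContDiff ℝ 3 ψ)
    (U : Set (E n)) (hU : IsOpen U) (zbar : E n) (hzbar : zbar ∈ U)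
    -- `(x(·,z), p(·,z))` solves the Pontryagin system with terminal data `(z, ∇ψ(z))`
    (x p : ℝ → E n → E n)
    (hxode : ∀ z ∈ U, ∀ t ∈ Set.Icc (0 : ℝ) T,
        HasDerivAt (fun s => x s z) (f (x t z) (ustar (x t z) (p t z))) t)
    (hpode : ∀ z ∈ U, ∀ t ∈ Set.Icc (0 : ℝ) T, ∀ h : E n,
        HasDerivAt (fun s => ⟪p s z, h⟫_ℝ)
          (-⟪p t z, fderiv ℝ (fun y => f y (ustar (x t z) (p t z))) (x t z) h⟫_ℝ
            - fderiv ℝ (fun y => L y (ustar (x t z) (p t z))) (x t z) h) t)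
    (hxT : ∀ z ∈ U, x T z = z)
    (hpT : ∀ z ∈ U, p T z = gradient ψ z)
    -- regularity: `x` and `p` are three times continuously differentiable
    (hxreg : ContDiffOn ℝ 3 (fun q : ℝ × E n => x q.1 q.2) (Set.Icc 0 T ×ˢ U))
    (hpreg : ContDiffOn ℝ 3 (fun q : ℝ × E n => p q.1 q.2) (Set.Icc 0 T ×ˢ U))
    -- `x̃(·,z)` starts at `x(0,z̄)` and uses the control `u(·,z) = ustar(x(·,z),p(·,z))`
    (xt : ℝ → E n → E n)
    (hxt0 : ∀ z ∈ U, xt 0 z = x 0 zbar)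
    (hxtode : ∀ z ∈ U, ∀ t ∈ Set.Icc (0 : ℝ) T,
        HasDerivAt (fun s => xt s z) (f (xt t z) (ustar (x t z) (p t z))) t)
    (hxtreg : ContDiffOn ℝ 3 (fun q : ℝ × E n => xt q.1 q.2) (Set.Icc 0 T ×ˢ U))
    -- the auxiliary cost `g(z, z̄)`
    (g : E n → ℝ)
    (hg : ∀ z, g z =
      (∫ t in (0 : ℝ)..T, L (xt t z) (ustar (x t z) (p t z))) + ψ (xt T z))
    -- `v` is a unit vector with `x_z(0, z̄) v = 0`
    (v : E n) (hv : ‖v‖ = 1)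
    (hker : fderiv ℝ (x 0) zbar v = 0) :
    (∀ᶠ θ in nhds (0 : ℝ), DifferentiableAt ℝ (fun θ' : ℝ => g (zbar + θ' • v)) θ)
    ∧ DifferentiableAt ℝ (deriv fun θ' : ℝ => g (zbar + θ' • v)) 0
    ∧ deriv (fun θ' : ℝ => g (zbar + θ' • v)) 0 = 0
    ∧ deriv (deriv fun θ' : ℝ => g (zbar + θ' • v)) 0 = 0 := by
  have hf : ContDiff ℝ 3 (fun q : E n × E m => f q.1 q.2) := by
    simp only [hfdef]
    refine (ContDiff.comp (f := fun q : E n × E m => q.1) hf0 contDiff_fst).add (ContDiff.sum fun i _ => ?_)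
    have h1 : ContDiff ℝ 3 (fun q : E n × E m => q.2) := contDiff_snd
    have h2 : ContDiff ℝ 3 (fun q : E n × E m => q.2 i) := contDiff_euclidean.1 h1 i
    have h3 : ContDiff ℝ 3 (fun q : E n × E m => fi i q.1) := (hfi i).comp contDiff_fst
    exact h2.smul h3
  have hH := ham_contDiff L f hL hf
  have hstat : ∀ a : E n × E n,
      fderiv ℝ (fun ω => Ham L f (a, ω)) (ustar a.1 a.2) = 0 := by
    intro a
    apply IsLocalMin.fderiv_eq_zero
    exact Filter.Eventually.of_forall (fun ω => hustar a.1 a.2 ω)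
  have hus : ContDiff ℝ 2 (fun a : E n × E n => ustar a.1 a.2) := by
    refine stationary_contDiff (Ham L f) hH _ δL hδL hstat ?_
    intro a ω c
    have hLd : Differentiable ℝ (fun ω' => L a.1 ω') := by
      have h1 : Differentiable ℝ (fun q : E n × E m => L q.1 q.2) := hL.differentiable (by norm_num)
      exact h1.comp (f := fun ω' : E m => (a.1, ω')) (by fun_prop)
    let b : E m := WithLp.toLp 2 (fun i => ⟪a.2, fi i a.1⟫_ℝ)
    have e1 : (fun ω => Ham L f (a, ω)) =
        fun ω => L a.1 ω + (⟪a.2, f0 a.1⟫_ℝ + innerSL ℝ b ω) := by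
      funext ω
      simp only [Ham, hfdef, inner_add_right, inner_sum, inner_smul_right, innerSL_apply_apply]
      simp [b, PiLp.inner_apply]
    have e2 : fderiv ℝ (fun ω => Ham L f (a, ω)) =
        fun ω => fderiv ℝ (fun ω' => L a.1 ω') ω + innerSL ℝ b := by
      funext ω
      rw [e1]
      exact ((hLd ω).hasFDerivAt.add ((innerSL ℝ b).hasFDerivAt.const_add _)).fderiv
    have h1 := hconv a.1 ω c
    rw [iteratedFDeriv_two_apply] at h1
    rw [e2, fderiv_add_const]
    simpa using h1
  let I : Set ℝ := (fun θ : ℝ => zbar + θ • v) ⁻¹' U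
  have hI : IsOpen I := hU.preimage (by fun_prop)
  have h0I : (0 : ℝ) ∈ I := by simpa [I] using hzbar
  have hcomp : ∀ (A : ℝ → E n → E n),
      ContDiffOn ℝ 3 (fun q : ℝ × E n => A q.1 q.2) (Set.Icc 0 T ×ˢ U) →
      ContDiffOn ℝ 2 (fun q : ℝ × ℝ => A q.1 (zbar + q.2 • v)) (Set.Icc 0 T ×ˢ I) := by
    intro A hA
    have hA2 := hA.of_le (show (2 : WithTop ℕ∞) ≤ 3 by norm_num)
    exact hA2.comp (f := fun q : ℝ × ℝ => (q.1, zbar + q.2 • v))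
      (ContDiff.contDiffOn (by fun_prop)) (fun q hq => ⟨hq.1, hq.2⟩)
  have hxd : DifferentiableAt ℝ (x 0) zbar := by
    have h1 : ContDiffOn ℝ 3 (x 0) U := hxreg.comp (f := fun z : E n => ((0 : ℝ), z))
      (ContDiff.contDiffOn (by fun_prop)) (fun z hz => ⟨⟨le_rfl, hT.le⟩, hz⟩)
    exact (h1.differentiableOn (by norm_num) zbar hzbar).differentiableAt (hU.mem_nhds hzbar)
  obtain ⟨G1, hG1, hG2, hG3⟩ := core L f hL hf ψ hψ T hT I hI h0I
    (fun t θ => x t (zbar + θ • v)) (fun t θ => p t (zbar + θ • v))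
    (fun t θ => xt t (zbar + θ • v))
    (fun t θ => ustar (x t (zbar + θ • v)) (p t (zbar + θ • v)))
    (hcomp x hxreg) (hcomp p hpreg) (hcomp xt hxtreg)
    (hus.comp_contDiffOn ((hcomp x hxreg).prodMk (hcomp p hpreg)))
    (fun θ hθ => hxode _ hθ) (fun θ hθ => hxtode _ hθ) (fun θ hθ => hpode _ hθ)
    (fun θ hθ => by simp only [hxT _ hθ, hpT _ hθ])
    (fun θ hθ t ht => hstat (x t (zbar + θ • v), p t (zbar + θ • v)))
    (fun θ hθ => by simp only [hxt0 _ hθ, zero_smul, add_zero])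
    (by
      have h2 : HasDerivAt (fun θ : ℝ => zbar + θ • v) v 0 := by
        simpa using ((hasDerivAt_id (0 : ℝ)).smul_const v).const_add zbar
      have h1 : HasFDerivAt (x 0) (fderiv ℝ (x 0) zbar) (zbar + (0 : ℝ) • v) := by
        simpa using hxd.hasFDerivAt
      have h3 := h1.comp_hasDerivAt (0 : ℝ) h2
      rw [hker] at h3
      exact h3.deriv)
  have hgG : (fun θ' : ℝ => g (zbar + θ' • v)) = fun θ : ℝ =>
      (∫ t in (0 : ℝ)..T, L (xt t (zbar + θ • v))
        (ustar (x t (zbar + θ • v)) (p t (zbar + θ • v)))) + ψ (xt T (zbar + θ • v)) := by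
    funext θ
    exact hg _
  rw [hgG]
  have hde : deriv (fun θ : ℝ =>
      (∫ t in (0 : ℝ)..T, L (xt t (zbar + θ • v))
        (ustar (x t (zbar + θ • v)) (p t (zbar + θ • v)))) + ψ (xt T (zbar + θ • v)))
      =ᶠ[nhds 0] G1 := by
    filter_upwards [hG1] with θ h using h.deriv
  have hd2 := hG2.congr_of_eventuallyEq hde
  refine ⟨?_, hd2.differentiableAt, ?_, hd2.deriv⟩
  · filter_upwards [hG1] with θ h using h.differentiableAt
  · rw [hde.self_of_nhds, hG3]
end
end

section
/- (Necessary condition at a conjugate point.) Suppose u(·,z̄) is a weak local minimizer for the initial point x̄ := x(0,z̄): there exists δ > 0 such that J^{x̄}[u(·,z̄)] ≤ J^{x̄}[u] for every measurable u : [0,T] → ℝᵐ with ‖u − u(·,z̄)‖_{L∞} < δ, where J^{x̄}[u] := ∫₀ᵀ L(x(t),u(t)) dt + ψ(x(T)) and x solves ẋ = f(x,u), x(0) = x̄. Suppose moreover z ↦ u(·,z) is continuous from U into L^∞([0,T];ℝᵐ) at z̄. If v ∈ ℝⁿ is a unit vector with x_z(0,z̄)v = 0, then ( p_z(0,z̄)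 v ) · ( x_{zz}(0,z̄)(v,v) ) = 0, where p_z(0,z̄) is the z-Jacobian of z ↦ p(0,z) and x_{zz}(0,z̄)(v,v) is the second z-derivative of z ↦ x(0,z) evaluated on (v,v). -/
open scoped InnerProductSpace

noncomputable section

section Helpers

open scoped Topology
open Filter

lemma littleo_int {W : Type*} [NormedAddCommGroup W] [NormedSpace ℝ W] (G G' : ℝ → W) (k : ℕ)
    (hG : ∀ᶠ r in 𝓝 (0:ℝ), HasDerivAt G (G' r) r) (h0 : G 0 = 0)
    (ho : ∀ ε > (0:ℝ), ∀ᶠ r in 𝓝 (0:ℝ), ‖G' r‖ ≤ ε * |r| ^ k) :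
    ∀ ε > (0:ℝ), ∀ᶠ r in 𝓝 (0:ℝ), ‖G r‖ ≤ ε * |r| ^ (k+1) := by
  intro ε hε
  obtain ⟨δ, hδ, H⟩ := Metric.eventually_nhds_iff_ball.1 (hG.and (ho ε hε))
  refine Metric.eventually_nhds_iff_ball.2 ⟨δ, hδ, fun r hr => ?_⟩
  have hr' : |r| < δ := by simpa using hr
  have key := Convex.norm_image_sub_le_of_norm_hasDerivWithin_le (f := G) (f' := G')
    (s := Metric.closedBall (0:ℝ) |r|) (C := ε * |r| ^ k) (x := 0) (y := r)
    (fun s hs => (H s (by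
      have : |s| ≤ |r| := by simpa using hs
      simpa using this.trans_lt hr')).1.hasDerivWithinAt)
    (fun s hs => by
      have hs' : |s| ≤ |r| := by simpa using hs
      refine (H s (by simpa using hs'.trans_lt hr')).2.trans ?_
      gcongr)
    (convex_closedBall _ _) (by simp) (by simp)
  rw [h0, sub_zero, sub_zero, Real.norm_eq_abs] at key
  rw [pow_succ, ← mul_assoc]; exact key

lemma second_taylor {V : Type*} [NormedAddCommGroup V] [NormedSpace ℝ V]
    (X X' : ℝ → V) (X2 : V)
    (hX : ∀ᶠ r in 𝓝 (0:ℝ), HasDerivAt X (X' r) r)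
    (hX0 : X' 0 = 0) (hX2 : HasDerivAt X' X2 0) :
    ∀ ε > (0:ℝ), ∀ᶠ r in 𝓝 (0:ℝ), ‖X r - X 0 - (r^2/2) • X2‖ ≤ ε * |r| ^ 2 := by
  refine littleo_int (fun r => X r - X 0 - (r^2/2) • X2) (fun r => X' r - r • X2) 1 ?_ (by simp) ?_
  · filter_upwards [hX] with r hr
    refine (hr.sub_const _).sub ?_
    have : HasDerivAt (fun r : ℝ => r^2/2) r r := by
      exact ((hasDerivAt_pow 2 r).div_const 2).congr_deriv (by simp)
    exact this.smul_const X2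
  · intro ε hε
    have := (hasDerivAt_iff_isLittleO.1 hX2).def hε
    filter_upwards [this] with r hr
    simpa [hX0] using hr

lemma final_analysis {V : Type*} [NormedAddCommGroup V] [InnerProductSpace ℝ V]
    (X X' P P' : ℝ → V) (X2 : V) (Φ : ℝ → ℝ) (C : ℝ)
    (hX : ∀ᶠ r in 𝓝 (0:ℝ), HasDerivAt X (X' r) r)
    (hP : ∀ᶠ r in 𝓝 (0:ℝ), HasDerivAt P (P' r) r)
    (hX0 : X' 0 = 0) (hX2 : HasDerivAt X' X2 0) (hP' : ContinuousAt P' 0)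
    (hΦ : ∀ᶠ r in 𝓝 (0:ℝ), HasDerivAt Φ ⟪P r, X' r⟫_ℝ r)
    (hpos : ∀ᶠ r in 𝓝 (0:ℝ), 0 ≤ Φ r - Φ 0 + ⟪P r, X 0 - X r⟫_ℝ + C * r ^ 4) :
    ⟪P' 0, X2⟫_ℝ = 0 := by
  have h1 := second_taylor X X' X2 hX hX0 hX2
  set κ := ⟪P' 0, X2⟫_ℝ with hκ
  have h2 : ∀ ε > (0:ℝ), ∀ᶠ r in 𝓝 (0:ℝ),
      ‖(Φ r - Φ 0 + ⟪P r, X 0 - X r⟫_ℝ) + κ/6 * r^3‖ ≤ ε * |r| ^ 3 := by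
    refine littleo_int (fun r => (Φ r - Φ 0 + ⟪P r, X 0 - X r⟫_ℝ) + κ/6 * r^3)
      (fun r => - ⟪P' r, X r - X 0⟫_ℝ + κ/2 * r^2) 2 ?_ (by simp) ?_
    · filter_upwards [hX, hP, hΦ] with r hx hp hφ
      have h3 : HasDerivAt (fun r : ℝ => κ/6 * r^3) (κ/2 * r^2) r := by
        exact ((hasDerivAt_pow 3 r).const_mul (κ/6)).congr_deriv (by push_cast; ring)
      refine HasDerivAt.add ?_ h3
      refine ((hφ.sub_const (Φ 0)).fun_add (hp.inner ℝ (hx.const_sub (X 0)))).congr_deriv ?_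
      rw [← neg_sub (X r), inner_neg_right, inner_neg_right]; ring
    · intro ε hε
      -- P' r → P' 0
      set A := ‖P' 0‖ + 1
      have hA : 0 < A := by positivity
      set B := ‖X2‖ + 1
      have hB : 0 < B := by positivity
      have e1 := Metric.tendsto_nhds.1 hP' (ε / B) (by positivity)
      have e2 := Metric.tendsto_nhds.1 hP' 1 one_pos
      have e3 := h1 (ε / (2*A)) (by positivity)
      filter_upwards [e1, e2, e3] with r r1 r2 r3
      have hPA : ‖P' r‖ ≤ A := by
        rw [dist_eq_norm] at r2
        have := norm_le_norm_add_norm_sub (P' 0) (P' r)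
        rw [norm_sub_rev] at this
        simp only [A]; linarith
      have hid : - ⟪P' r, X r - X 0⟫_ℝ + κ/2 * r^2 =
          - ⟪P' r, X r - X 0 - (r^2/2) • X2⟫_ℝ - r^2/2 * ⟪P' r - P' 0, X2⟫_ℝ := by
        rw [inner_sub_right _ _ ((r^2/2) • X2), inner_smul_right, inner_sub_left, hκ]; ring
      rw [hid]
      have n1 := norm_inner_le_norm (𝕜 := ℝ) (P' r) (X r - X 0 - (r^2/2) • X2)
      have n2 := norm_inner_le_norm (𝕜 := ℝ) (P' r - P' 0) X2
      have m1 : ‖P' r‖ * ‖X r - X 0 - (r^2/2) • X2‖ ≤ A * (ε / (2*A) * |r|^2) := by gcongr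
      have m2 : ‖P' r - P' 0‖ * ‖X2‖ ≤ ε / B * B := by
        rw [dist_eq_norm] at r1
        gcongr; simp [B]
      have k1 : A * (ε / (2*A) * |r|^2) = ε/2 * |r|^2 := by field_simp
      have k2 : ε / B * B = ε := by field_simp
      calc _ ≤ ‖⟪P' r, X r - X 0 - (r^2/2) • X2⟫_ℝ‖ + ‖r^2/2 * ⟪P' r - P' 0, X2⟫_ℝ‖ := by
            refine (norm_sub_le _ _).trans ?_
            rw [norm_neg]
        _ ≤ ε/2 * |r|^2 + |r|^2/2 * ε := by
            refine add_le_add (by linarith) ?_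
            rw [norm_mul, sq_abs, Real.norm_of_nonneg (by positivity : 0 ≤ r^2/2)]
            gcongr; linarith
        _ = _ := by ring
  -- conclude
  by_contra hne
  have hk : 0 < |κ| := abs_pos.2 hne
  have h4 := (h2 (|κ|/24) (by positivity)).and hpos
  obtain ⟨δ, hδ, H⟩ := Metric.eventually_nhds_iff_ball.1 h4
  obtain ⟨ρ, hρ, hρ1, hρ2⟩ : ∃ ρ > 0, ρ < δ ∧ (|C|) * ρ < |κ|/24 := by
    refine ⟨min (δ/2) (|κ|/48/(|C|+1)), by positivity, (min_le_left _ _).trans_lt (by linarith), ?_⟩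
    have : |C| * min (δ/2) (|κ|/48/(|C|+1)) ≤ (|C|+1) * (|κ|/48/(|C|+1)) := by
      gcongr
      · linarith
      · exact min_le_right _ _
    have e : (|C|+1) * (|κ|/48/(|C|+1)) = |κ|/48 := by field_simp
    linarith
  have hC4 : C * ρ^4 ≤ |κ|/24 * ρ^3 := by
    calc C * ρ^4 ≤ |C| * ρ^4 := by gcongr; exact le_abs_self C
      _ = (|C| * ρ) * ρ^3 := by ring
      _ ≤ _ := by gcongr
  obtain ⟨a1, a2⟩ := H ρ (by simpa [abs_of_pos hρ] using hρ1)
  obtain ⟨b1, b2⟩ := H (-ρ) (by simpa [abs_of_pos hρ] using hρ1)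
  rw [Real.norm_eq_abs, abs_of_pos hρ] at a1
  rw [Real.norm_eq_abs, abs_neg, abs_of_pos hρ] at b1
  have a3 := (abs_le.1 a1).2
  have b3 := (abs_le.1 b1).2
  have c1 : (-ρ)^4 = ρ^4 := by ring
  have c2 : (-ρ)^3 = -ρ^3 := by ring
  rw [c1] at b2; rw [c2] at b3
  have hρ3 : 0 < ρ^3 := by positivity
  have hpp : 0 < |κ| * ρ^3 := by positivity
  rcases abs_cases κ with ⟨e, _⟩ | ⟨e, _⟩
  · rw [e] at hC4 a3 b3 hpp; nlinarith
  · rw [e] at hC4 a3 b3 hpp; nlinarith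

lemma uniform_taylor {V W : Type*} [NormedAddCommGroup V] [NormedSpace ℝ V] [FiniteDimensional ℝ V]
    [NormedAddCommGroup W] [NormedSpace ℝ W] (g : V → W) (hg : ContDiff ℝ 2 g) (R : ℝ) :
    ∃ C : ℝ, 0 ≤ C ∧ ∀ y ∈ Metric.closedBall (0:V) R, ∀ y' ∈ Metric.closedBall (0:V) R,
      ‖g y' - g y - fderiv ℝ g y (y' - y)‖ ≤ C * ‖y' - y‖ ^ 2 := by
  have hd : ContDiff ℝ 1 (fderiv ℝ g) := hg.fderiv_right (by norm_num)
  obtain ⟨K, hK⟩ : ∃ K, LipschitzOnWith K (fderiv ℝ g) (Metric.closedBall (0:V) R) :=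
    (hd.locallyLipschitz.locallyLipschitzOn).exists_lipschitzOnWith_of_compact
      (isCompact_closedBall _ _)
  refine ⟨K, K.2, fun y hy y' hy' => ?_⟩
  have hsub : segment ℝ y y' ⊆ Metric.closedBall (0:V) R :=
    (convex_closedBall _ _).segment_subset hy hy'
  have := Convex.norm_image_sub_le_of_norm_hasFDerivWithin_le' (f := g) (f' := fderiv ℝ g)
    (φ := fderiv ℝ g y) (s := segment ℝ y y') (C := K * ‖y' - y‖) (x := y) (y := y')
    (fun z hz => ((hg.differentiable (by norm_num)) z).hasFDerivAt.hasFDerivWithinAt)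
    (fun z hz => by
      refine (hK.norm_sub_le (hsub hz) hy).trans ?_
      gcongr
      obtain ⟨t, ht, rfl⟩ := (segment_eq_image' ℝ y y') ▸ hz
      simp only [add_sub_cancel_left, norm_smul, Real.norm_eq_abs]
      rw [abs_of_nonneg ht.1]
      nlinarith [norm_nonneg (y' - y), ht.2])
    (convex_segment _ _) (left_mem_segment _ _ _) (right_mem_segment _ _ _)
  calc _ ≤ _ := this
    _ = _ := by ring

lemma ustar_reg {Θ W : Type*} [NormedAddCommGroup Θ] [NormedSpace ℝ Θ] [FiniteDimensional ℝ Θ]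
    [NormedAddCommGroup W] [NormedSpace ℝ W] [FiniteDimensional ℝ W]
    (h : Θ × W → ℝ) (hh : ContDiff ℝ 2 h) (δ : ℝ) (hδ : 0 < δ)
    (hmono : ∀ θ w1 w2, δ * ‖w1 - w2‖^2 ≤
      fderiv ℝ h (θ, w1) (0, w1 - w2) - fderiv ℝ h (θ, w2) (0, w1 - w2))
    (us : Θ → W) (hus : ∀ θ c, fderiv ℝ h (θ, us θ) (0, c) = 0) (R : ℝ) :
    (∃ M : ℝ, ∀ θ ∈ Metric.closedBall (0:Θ) R, ‖us θ‖ ≤ M) ∧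
    ∃ C : ℝ, 0 ≤ C ∧ ∀ a ∈ Metric.closedBall (0:Θ) R, ∀ b ∈ Metric.closedBall (0:Θ) R,
      ‖us a - us b‖ ≤ C * ‖a - b‖ := by
  have hd : ContDiff ℝ 1 (fderiv ℝ h) := hh.fderiv_right (by norm_num)
  have hM : ∃ M : ℝ, ∀ θ ∈ Metric.closedBall (0:Θ) R, ‖us θ‖ ≤ M := by
    obtain ⟨B, hB⟩ := (isCompact_closedBall (0:Θ) R).exists_bound_of_continuousOn
      (f := fun θ => fderiv ℝ h (θ, (0:W))) (by
        have := hd.continuous; fun_prop)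
    refine ⟨B / δ, fun θ hθ => ?_⟩
    have h1 := hmono θ (us θ) 0
    rw [hus, sub_zero] at h1
    have h2 := (fderiv ℝ h (θ, (0:W))).le_opNorm (0, us θ)
    have h3 := hB θ hθ
    have h4 : ‖((0:Θ), us θ)‖ = ‖us θ‖ := by simp [Prod.norm_def]
    rw [h4] at h2
    have h5 := (abs_le.1 h2).1
    rw [le_div_iff₀ hδ]
    by_contra hcon
    push Not at hcon
    have h6 : 0 < ‖us θ‖ := by
      by_contra h0
      have : ‖us θ‖ = 0 := le_antisymm (not_lt.1 h0) (norm_nonneg _)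
      rw [this] at hcon
      linarith [norm_nonneg (fderiv ℝ h (θ, (0:W)))]
    nlinarith
  refine ⟨hM, ?_⟩
  obtain ⟨M, hM⟩ := hM
  obtain ⟨K, hK⟩ : ∃ K, LipschitzOnWith K (fderiv ℝ h)
      (Metric.closedBall (0:Θ) R ×ˢ Metric.closedBall (0:W) M) :=
    (hd.locallyLipschitz.locallyLipschitzOn).exists_lipschitzOnWith_of_compact
      ((isCompact_closedBall _ _).prod (isCompact_closedBall _ _))
  refine ⟨K / δ, by positivity, fun a ha b hb => ?_⟩
  have h1 := hmono a (us a) (us b)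
  have h2 := hK.norm_sub_le (x := (b, us b)) (y := (a, us b)) ⟨hb, by simpa using hM b hb⟩
    ⟨ha, by simpa using hM b hb⟩
  have h3 : ‖(b, us b) - (a, us b)‖ = ‖a - b‖ := by
    rw [Prod.mk_sub_mk, sub_self, Prod.norm_def]; simp [norm_sub_rev]
  rw [h3] at h2
  have h4 := (fderiv ℝ h (b, us b) - fderiv ℝ h (a, us b)).le_opNorm (0, us a - us b)
  have h5 : ‖((0:Θ), us a - us b)‖ = ‖us a - us b‖ := by simp [Prod.norm_def]
  rw [h5, sub_apply, hus] at h4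
  rw [hus] at h1
  have h6 := (le_abs_self _).trans h4
  rw [div_mul_eq_mul_div, le_div_iff₀ hδ]
  by_contra hcon
  push Not at hcon
  have h7 : 0 < ‖us a - us b‖ := by
    by_contra h0
    have : ‖us a - us b‖ = 0 := le_antisymm (not_lt.1 h0) (norm_nonneg _)
    rw [this] at hcon
    have : 0 ≤ K * ‖a - b‖ := by positivity
    linarith
  nlinarith

lemma ode_exists {V : Type*} [NormedAddCommGroup V] [InnerProductSpace ℝ V] [FiniteDimensional ℝ V]
    (T : ℝ) (hT : 0 < T) (K : NNReal) (g : ℝ → V → V)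
    (hcont : ∀ η, ContinuousOn (fun t => g t η) (Set.Icc 0 T))
    (hlip : ∀ t ∈ Set.Icc 0 T, LipschitzOnWith K (g t) (Metric.closedBall 0 2))
    (h0 : ∀ t ∈ Set.Icc 0 T, g t 0 = 0)
    (η0 : V) (hη0 : ‖η0‖ * Real.exp (K * T) ≤ 1) :
    ∃ η : ℝ → V, η 0 = η0 ∧
      (∀ t ∈ Set.Icc 0 T, HasDerivWithinAt η (g t (η t)) (Set.Icc 0 T) t) ∧
      ∀ t ∈ Set.Icc 0 T, ‖η t‖ ≤ ‖η0‖ * Real.exp (K * T) := by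
  let b : ContDiffBump (0:V) := ⟨1, 2, one_pos, one_lt_two⟩
  let π : V → V := fun η => b η • η
  obtain ⟨Kπ, hKπ⟩ : ∃ C, LipschitzWith C π := by
    refine ContDiff.lipschitzWith_of_hasCompactSupport (𝕂 := ℝ) (n := 1) ?_ ?_ one_ne_zero
    · exact b.hasCompactSupport.smul_right
    · exact b.contDiff.smul contDiff_id
  have hπle : ∀ η, ‖π η‖ ≤ ‖η‖ := fun η => by
    simp only [π, norm_smul, Real.norm_eq_abs, abs_of_nonneg b.nonneg]
    exact mul_le_of_le_one_left (norm_nonneg _) b.le_one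
  have hπ2 : ∀ η, π η ∈ Metric.closedBall (0:V) 2 := fun η => by
    rw [mem_closedBall_zero_iff]
    by_cases h : ‖η‖ ≤ 2
    · exact (hπle η).trans h
    · have : b η = 0 := b.zero_of_le_dist (by simpa using (not_le.1 h).le)
      simp [π, this]
  have hπ1 : ∀ η, ‖η‖ ≤ 1 → π η = η := fun η h => by
    have : b η = 1 := b.one_of_mem_closedBall (by simpa using h)
    simp [π, this]
  have hgb : ∀ t ∈ Set.Icc 0 T, ∀ η, ‖g t (π η)‖ ≤ K * ‖π η‖ := fun t ht η => by
    have := (hlip t ht).norm_sub_le (hπ2 η) (Metric.mem_closedBall_self (by norm_num))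
    simpa [h0 t ht] using this
  have hPL : IsPicardLindelof (fun t η => g t (π η)) (tmin := 0) (tmax := T)
      ⟨0, Set.left_mem_Icc.2 hT.le⟩ η0 (K * 2 * ⟨T, hT.le⟩) 0 (K * 2) (K * Kπ) := by
    refine ⟨fun t ht => ?_, fun η _ => hcont (π η), fun t ht η _ => ?_, ?_⟩
    · exact (hlip t ht).comp hKπ.lipschitzOnWith (fun η _ => hπ2 η)
    · refine (hgb t ht η).trans ?_
      have := hπ2 η
      rw [mem_closedBall_zero_iff] at this
      push_cast
      gcongr
    · simp [hT.le]
      exact le_of_eq rfl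
  obtain ⟨η, hη, hd⟩ := hPL.exists_eq_forall_mem_Icc_hasDerivWithinAt₀
  simp only at hη
  have hc : ContinuousOn η (Set.Icc 0 T) := fun t ht => (hd t ht).continuousWithinAt
  have hbd : ∀ t ∈ Set.Icc 0 T, ‖η t‖ ≤ ‖η0‖ * Real.exp (K * T) := by
    intro t ht
    have := norm_le_gronwallBound_of_norm_deriv_right_le (f := η) (f' := fun t => g t (π (η t)))
      (δ := ‖η0‖) (K := K) (ε := 0) hc
      (fun s hs => (hd s (Set.Ico_subset_Icc_self hs)).mono_of_mem_nhdsWithin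
        (Icc_mem_nhdsGE_of_mem hs)) (by rw [hη]) (fun s hs => by
        rw [add_zero]
        refine (hgb s (Set.Ico_subset_Icc_self hs) _).trans ?_
        gcongr; exact hπle _) t ht
    rw [gronwallBound_ε0] at this
    refine this.trans ?_
    gcongr
    linarith [ht.2]
  refine ⟨η, hη, fun t ht => ?_, hbd⟩
  have := hd t ht
  rwa [hπ1 _ ((hbd t ht).trans hη0)] at this

lemma key_estimate {V W : Type*} [NormedAddCommGroup V] [InnerProductSpace ℝ V]
    [FiniteDimensional ℝ V] [NormedAddCommGroup W] [NormedSpace ℝ W]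
    (T : ℝ) (hT : 0 < T) (F : V → W → V) (L : V → W → ℝ)
    (hL : Continuous fun q : V × W => L q.1 q.2)
    (h : (V × V) × W → ℝ) (hdef : ∀ y q w, h ((y, q), w) = L y w + ⟪q, F y w⟫_ℝ)
    (ψ : V → ℝ) (R C Cψ : ℝ) (hC : 0 ≤ C)
    (hTh : ∀ y ∈ Metric.closedBall (0:(V × V) × W) R, ∀ y' ∈ Metric.closedBall (0:(V × V) × W) R,
      ‖h y' - h y - fderiv ℝ h y (y' - y)‖ ≤ C * ‖y' - y‖ ^ 2)
    (hTψ : ∀ y ∈ Metric.closedBall (0:V) R, ∀ y' ∈ Metric.closedBall (0:V) R,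
      ‖ψ y' - ψ y - fderiv ℝ ψ y (y' - y)‖ ≤ Cψ * ‖y' - y‖ ^ 2) (hCψ : 0 ≤ Cψ)
    (xa pa : ℝ → V) (ua : ℝ → W)
    (hua : ContinuousOn ua (Set.Icc 0 T))
    (hxa : ∀ t ∈ Set.Icc 0 T, HasDerivAt xa (F (xa t) (ua t)) t)
    (hpa : ∀ t ∈ Set.Icc 0 T, ∀ k : V, HasDerivAt (fun s => ⟪pa s, k⟫_ℝ)
      (- fderiv ℝ h ((xa t, pa t), ua t) ((k, 0), 0)) t)
    (hst : ∀ t ∈ Set.Icc 0 T, ∀ c, fderiv ℝ h ((xa t, pa t), ua t) (0, c) = 0)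
    (hpT : ∀ k, fderiv ℝ ψ (xa T) k = ⟪pa T, k⟫_ℝ)
    (y : ℝ → V) (w : ℝ → W) (hw : ContinuousOn w (Set.Icc 0 T))
    (hy : ∀ t ∈ Set.Icc 0 T, HasDerivWithinAt y (F (y t) (w t)) (Set.Icc 0 T) t)
    (hxaR : ∀ t ∈ Set.Icc 0 T, ‖xa t‖ ≤ R) (hpaR : ∀ t ∈ Set.Icc 0 T, ‖pa t‖ ≤ R)
    (huaR : ∀ t ∈ Set.Icc 0 T, ‖ua t‖ ≤ R) (hyR : ∀ t ∈ Set.Icc 0 T, ‖y t‖ ≤ R)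
    (hwR : ∀ t ∈ Set.Icc 0 T, ‖w t‖ ≤ R)
    (d : ℝ) (hyd : ∀ t ∈ Set.Icc 0 T, ‖y t - xa t‖ ≤ d)
    (hwd : ∀ t ∈ Set.Icc 0 T, ‖w t - ua t‖ ≤ d) :
    |((∫ t in (0:ℝ)..T, L (y t) (w t)) + ψ (y T))
      - ((∫ t in (0:ℝ)..T, L (xa t) (ua t)) + ψ (xa T)) - ⟪pa 0, y 0 - xa 0⟫_ℝ|
      ≤ (C * T + Cψ) * d ^ 2 := by
  have h0m : (0:ℝ) ∈ Set.Icc 0 T := Set.left_mem_Icc.2 hT.le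
  have hTm : T ∈ Set.Icc 0 T := Set.right_mem_Icc.2 hT.le
  -- derivative of pa
  have hpd : ∀ t ∈ Set.Icc 0 T, ∃ D : V, HasDerivAt pa D t ∧
      ∀ k, ⟪D, k⟫_ℝ = - fderiv ℝ h ((xa t, pa t), ua t) ((k, 0), 0) := by
    intro t ht
    let b := stdOrthonormalBasis ℝ V
    let D : V := ∑ i, (- fderiv ℝ h ((xa t, pa t), ua t) ((b i, 0), 0)) • b i
    have hD : HasDerivAt pa D t := by
      have h1 : pa = fun s => ∑ i, ⟪pa s, b i⟫_ℝ • b i := by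
        funext s
        conv_lhs => rw [← b.sum_repr' (pa s)]
        simp only [real_inner_comm]
      rw [h1]
      exact HasDerivAt.fun_sum fun i _ => (hpa t ht (b i)).smul_const (b i)
    refine ⟨D, hD, fun k => ?_⟩
    have h2 := hD.inner ℝ (hasDerivAt_const t k)
    have h3 := h2.unique (hpa t ht k)
    simpa using h3
  have hxac : ContinuousOn xa (Set.Icc 0 T) := fun t ht => (hxa t ht).continuousAt.continuousWithinAt
  have hyc : ContinuousOn y (Set.Icc 0 T) := fun t ht => (hy t ht).continuousWithinAt
  have hpac : ContinuousOn pa (Set.Icc 0 T) := fun t ht => by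
    obtain ⟨D, hD, _⟩ := hpd t ht
    exact hD.continuousAt.continuousWithinAt
  have hL1 : ContinuousOn (fun t => L (y t) (w t)) (Set.Icc 0 T) := hL.comp_continuousOn (hyc.prodMk hw)
  have hL2 : ContinuousOn (fun t => L (xa t) (ua t)) (Set.Icc 0 T) :=
    hL.comp_continuousOn (hxac.prodMk hua)
  have hi1 : IntervalIntegrable (fun t => L (y t) (w t)) MeasureTheory.volume 0 T :=
    ContinuousOn.intervalIntegrable (by rwa [Set.uIcc_of_le hT.le])
  have hi2 : IntervalIntegrable (fun t => L (xa t) (ua t)) MeasureTheory.volume 0 T :=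
    ContinuousOn.intervalIntegrable (by rwa [Set.uIcc_of_le hT.le])
  -- a primitive-like function
  let I : ℝ → ℝ := fun t => (∫ s in (0:ℝ)..t, (L (y s) (w s) - L (xa s) (ua s)))
    + ⟪pa t, y t - xa t⟫_ℝ
  have hLd : ContinuousOn (fun s => L (y s) (w s) - L (xa s) (ua s)) (Set.Icc 0 T) := hL1.sub hL2
  have hId : ∀ t ∈ Set.Icc 0 T, HasDerivWithinAt I
      (h ((y t, pa t), w t) - h ((xa t, pa t), ua t)
        - fderiv ℝ h ((xa t, pa t), ua t) ((y t, pa t), w t) 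
        + fderiv ℝ h ((xa t, pa t), ua t) ((xa t, pa t), ua t)) (Set.Icc 0 T) t := by
    intro t ht
    obtain ⟨D, hD, hDk⟩ := hpd t ht
    have e1 : HasDerivWithinAt (fun t => ∫ s in (0:ℝ)..t, (L (y s) (w s) - L (xa s) (ua s)))
        (L (y t) (w t) - L (xa t) (ua t)) (Set.Icc 0 T) t := by
      have : Fact (t ∈ Set.Icc 0 T) := ⟨ht⟩
      refine intervalIntegral.integral_hasDerivWithinAt_right ?_ ?_ (hLd t ht)
      · refine ContinuousOn.intervalIntegrable (hLd.mono ?_)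
        rw [Set.uIcc_of_le ht.1]; exact Set.Icc_subset_Icc_right ht.2
      · exact hLd.stronglyMeasurableAtFilter_nhdsWithin measurableSet_Icc t
    have e2 := hD.hasDerivWithinAt.inner ℝ ((hy t ht).sub (hxa t ht).hasDerivWithinAt) (s := Set.Icc 0 T)
    refine (e1.fun_add e2).congr_deriv ?_
    have e3 : ((y t, pa t), w t) = ((xa t, pa t), ua t) + ((y t - xa t, 0), 0) + (0, w t - ua t) := by
      simp
    have e4 : fderiv ℝ h ((xa t, pa t), ua t) ((y t, pa t), w t) =
      fderiv ℝ h ((xa t, pa t), ua t) ((xa t, pa t), ua t) +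
      fderiv ℝ h ((xa t, pa t), ua t) ((y t - xa t, 0), 0) := by
      conv_lhs => rw [e3, map_add, hst t ht, add_zero, map_add]
    rw [e4, hdef, hdef]
    simp only [Pi.sub_apply]
    rw [hDk, inner_sub_right]; ring
  have hIb : ∀ t ∈ Set.Ico 0 T, ‖h ((y t, pa t), w t) - h ((xa t, pa t), ua t)
        - fderiv ℝ h ((xa t, pa t), ua t) ((y t, pa t), w t) 
        + fderiv ℝ h ((xa t, pa t), ua t) ((xa t, pa t), ua t)‖ ≤ C * d ^ 2 := by
    intro t ht'
    have ht := Set.Ico_subset_Icc_self ht'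
    have := hTh ((xa t, pa t), ua t) (by
      rw [mem_closedBall_zero_iff]; simp [Prod.norm_def, hxaR t ht, hpaR t ht, huaR t ht])
      ((y t, pa t), w t) (by
      rw [mem_closedBall_zero_iff]; simp [Prod.norm_def, hyR t ht, hpaR t ht, hwR t ht])
    rw [map_sub, ← sub_add] at this
    refine this.trans ?_
    gcongr
    have hd0 : 0 ≤ d := (norm_nonneg _).trans (hyd t ht)
    simp [Prod.norm_def, hyd t ht, hwd t ht]
  have hI := norm_image_sub_le_of_norm_deriv_le_segment' hId hIb T hTm
  have hψ := hTψ (xa T) (by simpa using hxaR T hTm) (y T) (by simpa using hyR T hTm)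
  have hψ2 : Cψ * ‖y T - xa T‖ ^ 2 ≤ Cψ * d ^ 2 := by
    gcongr; exact hyd T hTm
  rw [hpT] at hψ
  simp only [I] at hI
  rw [intervalIntegral.integral_same, intervalIntegral.integral_sub hi1 hi2, Real.norm_eq_abs] at hI
  rw [Real.norm_eq_abs] at hψ
  rw [abs_le] at hI hψ ⊢
  constructor <;> nlinarith

lemma line_deriv {V W : Type*} [NormedAddCommGroup V] [NormedSpace ℝ V]
    [NormedAddCommGroup W] [NormedSpace ℝ W] (g : V → W) (a c : V) (s : ℝ)
    (hg : DifferentiableAt ℝ g (a + s • c)) :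
    HasDerivAt (fun s : ℝ => g (a + s • c)) (fderiv ℝ g (a + s • c) c) s := by
  have hline : HasDerivAt (fun s : ℝ => a + s • c) c s := by
    simpa using ((hasDerivAt_id s).smul_const c).const_add a
  exact hg.hasFDerivAt.comp_hasDerivAt s hline

def ham {n m : ℕ} (f : E n → E m → E n) (L : E n → E m → ℝ) : (E n × E n) × E m → ℝ :=
  fun q => L q.1.1 q.2 + ⟪q.1.2, f q.1.1 q.2⟫_ℝ

lemma f_contDiff {n m : ℕ} (f0 : E n → E n) (fi : Fin m → E n → E n)
    (hf0 : ContDiff ℝ 3 f0) (hfi : ∀ i, ContDiff ℝ 3 (fi i))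
    (f : E n → E m → E n)
    (hfdef : ∀ y ω, f y ω = f0 y + ∑ i, ω i • fi i y) :
    ContDiff ℝ 3 (fun q : E n × E m => f q.1 q.2) := by
  simp only [hfdef]
  refine (hf0.comp contDiff_fst).add (ContDiff.sum fun i _ => ?_)
  have h2 : ContDiff ℝ 3 (fun q : E n × E m => fi i q.1) := (hfi i).comp contDiff_fst
  refine ContDiff.smul (f := fun q : E n × E m => q.2 i) (g := fun q : E n × E m => fi i q.1) ?_ h2
  exact (contDiff_euclidean.1 (contDiff_snd (𝕜 := ℝ) (E := E n) (F := E m))) i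

lemma ham_contDiff_s11 {n m : ℕ} (f : E n → E m → E n) (L : E n → E m → ℝ)
    (hf : ContDiff ℝ 3 (fun q : E n × E m => f q.1 q.2))
    (hL : ContDiff ℝ 3 (fun q : E n × E m => L q.1 q.2)) : ContDiff ℝ 3 (ham f L) := by
  have h1 : ContDiff ℝ 3 (fun q : (E n × E n) × E m => (q.1.1, q.2)) :=
    (contDiff_fst.comp contDiff_fst).prodMk contDiff_snd
  exact (hL.comp h1).add ((contDiff_snd.comp contDiff_fst).inner ℝ (hf.comp h1))

lemma ham_stat {n m : ℕ} (f : E n → E m → E n) (L : E n → E m → ℝ)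
    (hh : Differentiable ℝ (ham f L)) (y q : E n) (u : E m)
    (hu : ∀ ω : E m, L y u + ⟪q, f y u⟫_ℝ ≤ L y ω + ⟪q, f y ω⟫_ℝ) (c : E m) :
    fderiv ℝ (ham f L) ((y, q), u) (0, c) = 0 := by
  have h1 : HasFDerivAt (fun ω => ham f L ((y, q), ω)) _ u :=
    (hh ((y, q), u)).hasFDerivAt.comp u (hasFDerivAt_prodMk_right (𝕜 := ℝ) (y, q) u)
  have h2 : IsLocalMin (fun ω => ham f L ((y, q), ω)) u := Eventually.of_forall fun ω => hu ω
  have h3 := h2.hasFDerivAt_eq_zero h1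
  simpa using congrArg (fun A => A c) h3

lemma ham_x {n m : ℕ} (f : E n → E m → E n) (L : E n → E m → ℝ)
    (hf : ContDiff ℝ 3 (fun q : E n × E m => f q.1 q.2))
    (hL : ContDiff ℝ 3 (fun q : E n × E m => L q.1 q.2)) (y q : E n) (u : E m) (k : E n) :
    fderiv ℝ (ham f L) ((y, q), u) ((k, 0), 0) =
      ⟪q, fderiv ℝ (fun y => f y u) y k⟫_ℝ + fderiv ℝ (fun y => L y u) y k := by
  have hh := ham_contDiff_s11 f L hf hL
  have h1 : HasFDerivAt (fun y' => ham f L ((y', q), u)) _ y :=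
    HasFDerivAt.comp (g := ham f L) (f := fun y' => ((y', q), u)) y
      ((hh.differentiable (by norm_num)) ((y, q), u)).hasFDerivAt
      (((hasFDerivAt_id y).prodMk (hasFDerivAt_const q y)).prodMk (hasFDerivAt_const u y))
  have e1 : DifferentiableAt ℝ (fun y => f y u) y := by
    have : ContDiff ℝ 3 (fun y => f y u) := hf.comp (contDiff_id.prodMk contDiff_const)
    exact (this.differentiable (by norm_num)) y
  have e2 : DifferentiableAt ℝ (fun y => L y u) y := by
    have : ContDiff ℝ 3 (fun y => L y u) := hL.comp (contDiff_id.prodMk contDiff_const)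
    exact (this.differentiable (by norm_num)) y
  have h2 : HasFDerivAt (fun y' => ham f L ((y', q), u)) _ y :=
    e2.hasFDerivAt.add ((hasFDerivAt_const q y).inner ℝ e1.hasFDerivAt)
  have h3 := congrArg (fun A => A k) (h1.unique h2)
  simp at h3
  rw [h3]; ring

lemma ham_mono {n m : ℕ} (f0 : E n → E n) (fi : Fin m → E n → E n)
    (f : E n → E m → E n) (hfdef : ∀ y ω, f y ω = f0 y + ∑ i, ω i • fi i y)
    (L : E n → E m → ℝ)
    (hL : ContDiff ℝ 3 (fun q : E n × E m => L q.1 q.2))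
    (hh : Differentiable ℝ (ham f L))
    (δL : ℝ)
    (hconv : ∀ y ω, ∀ c : E m,
      δL * ‖c‖ ^ 2 ≤ iteratedFDeriv ℝ 2 (fun ω' => L y ω') ω ![c, c])
    (θ : E n × E n) (w1 w2 : E m) :
    δL * ‖w1 - w2‖^2 ≤
      fderiv ℝ (ham f L) (θ, w1) (0, w1 - w2) - fderiv ℝ (ham f L) (θ, w2) (0, w1 - w2) := by
  obtain ⟨y, q⟩ := θ
  set c := w1 - w2 with hc
  have hLy : ContDiff ℝ 3 (fun ω => L y ω) := hL.comp (contDiff_const.prodMk contDiff_id)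
  have hLd : Differentiable ℝ (fun ω => L y ω) := hLy.differentiable (by norm_num)
  have hLd2 : Differentiable ℝ (fderiv ℝ (fun ω => L y ω)) :=
    (hLy.fderiv_right (m := 2) (by norm_num)).differentiable (by norm_num)
  -- formula
  have hform : ∀ w, fderiv ℝ (ham f L) ((y, q), w) (0, c) =
      fderiv ℝ (fun ω => L y ω) w c + ⟪q, ∑ i, c i • fi i y⟫_ℝ := by
    intro w
    have h1 : HasDerivAt (fun s : ℝ => ham f L ((y, q), w + s • c))
        (fderiv ℝ (ham f L) ((y, q), w) (0, c)) 0 := by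
      have := line_deriv (ham f L) ((y, q), w) (0, c) 0 (hh _)
      simpa using this
    have h2 : HasDerivAt (fun s : ℝ => ham f L ((y, q), w + s • c))
        (fderiv ℝ (fun ω => L y ω) w c + ⟪q, ∑ i, c i • fi i y⟫_ℝ) 0 := by
      have e : (fun s : ℝ => ham f L ((y, q), w + s • c)) = fun s : ℝ =>
          L y (w + s • c) + (⟪q, f y w⟫_ℝ + s * ⟪q, ∑ i, c i • fi i y⟫_ℝ) := by
        funext s
        simp only [ham, hfdef]
        rw [← real_inner_smul_right, ← inner_add_right]
        congr 2
        simp only [PiLp.add_apply, PiLp.smul_apply, smul_eq_mul, add_smul, Finset.sum_add_distrib,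
          Finset.smul_sum, mul_smul, add_assoc]
      rw [e]
      refine HasDerivAt.fun_add ?_ ?_
      · have := line_deriv (fun ω => L y ω) w c 0 (hLd _)
        simpa using this
      · simpa using ((hasDerivAt_id (0:ℝ)).mul_const ⟪q, ∑ i, c i • fi i y⟫_ℝ).const_add ⟪q, f y w⟫_ℝ
    exact h1.unique h2
  rw [hform, hform]
  have hφ : ∀ s : ℝ, HasDerivAt (fun s : ℝ => fderiv ℝ (fun ω => L y ω) (w2 + s • c) c - δL * ‖c‖^2 * s)
      (fderiv ℝ (fderiv ℝ (fun ω => L y ω)) (w2 + s • c) c c - δL * ‖c‖^2) s := by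
    intro s
    have h1 := (line_deriv (fderiv ℝ (fun ω => L y ω)) w2 c s (hLd2 _)).clm_apply (hasDerivAt_const s c)
    have h2 := (hasDerivAt_id s).const_mul (δL * ‖c‖^2)
    refine (h1.fun_sub h2).congr_deriv ?_
    simp
  have hm : Monotone (fun s : ℝ => fderiv ℝ (fun ω => L y ω) (w2 + s • c) c - δL * ‖c‖^2 * s) := by
    refine monotone_of_deriv_nonneg (fun s => (hφ s).differentiableAt) fun s => ?_
    rw [(hφ s).deriv]
    have := hconv y (w2 + s • c) c
    rw [iteratedFDeriv_two_apply] at this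
    simpa using this
  have := hm (zero_le_one)
  simp only [zero_smul, add_zero, one_smul, mul_zero, mul_one, sub_zero] at this
  rw [hc, add_sub_cancel, ← hc] at this
  linarith

end Helpers

/-- Theorem 2.2 of the paper (necessary condition at a conjugate point): if
`u(·,z̄)` is a weak local minimizer for the initial point `x̄ = x(0,z̄)`,
`z ↦ u(·,z)` is `L^∞`-continuous at `z̄`, and `v` is a unit vector with
`x_z(0,z̄) v = 0`, then `(p_z(0,z̄) v) · (x_{zz}(0,z̄)(v,v)) = 0`. -/
theorem conjugate_point_necessary_condition
    (n m : ℕ) (hn : 1 ≤ n) (hm : 1 ≤ m) (T : ℝ) (hT : 0 < T)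
    -- the control-linear dynamics
    (f0 : E n → E n) (fi : Fin m → E n → E n)
    (hf0 : ContDiff ℝ 3 f0) (hfi : ∀ i, ContDiff ℝ 3 (fi i))
    (c1 : ℝ) (hc1 : 0 < c1)
    (hgrowth0 : ∀ y : E n, ‖f0 y‖ ≤ c1 * (‖y‖ + 1))
    (hgrowth : ∀ i, ∀ y : E n, ‖fi i y‖ ≤ c1 * (‖y‖ + 1))
    (f : E n → E m → E n)
    (hfdef : ∀ y ω, f y ω = f0 y + ∑ i, ω i • fi i y)
    -- the running cost, three times continuously differentiable, uniformly convex in `u`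
    (L : E n → E m → ℝ)
    (hL : ContDiff ℝ 3 (fun q : E n × E m => L q.1 q.2))
    (δL : ℝ) (hδL : 0 < δL)
    (hconv : ∀ y ω, ∀ c : E m,
      δL * ‖c‖ ^ 2 ≤ iteratedFDeriv ℝ 2 (fun ω' => L y ω') ω ![c, c])
    -- `ustar y q` is the pointwise minimizer of `ω ↦ L y ω + ⟪q, f y ω⟫`
    (ustar : E n → E n → E m)
    (hustar : ∀ y q : E n, ∀ ω : E m,
      L y (ustar y q) + ⟪q, f y (ustar y q)⟫_ℝ ≤ L y ω + ⟪q, f y ω⟫_ℝ)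
    -- the terminal cost
    (ψ : E n → ℝ) (hψ : ContDiff ℝ 3 ψ)
    (U : Set (E n)) (hU : IsOpen U) (zbar : E n) (hzbar : zbar ∈ U)
    -- `(x(·,z), p(·,z))` solves the Pontryagin system with terminal data `(z, ∇ψ(z))`
    (x p : ℝ → E n → E n)
    (hxode : ∀ z ∈ U, ∀ t ∈ Set.Icc (0 : ℝ) T,
        HasDerivAt (fun s => x s z) (f (x t z) (ustar (x t z) (p t z))) t)
    (hpode : ∀ z ∈ U, ∀ t ∈ Set.Icc (0 : ℝ) T, ∀ h : E n,
        HasDerivAt (fun s => ⟪p s z, h⟫_ℝ)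
          (-⟪p t z, fderiv ℝ (fun y => f y (ustar (x t z) (p t z))) (x t z) h⟫_ℝ
            - fderiv ℝ (fun y => L y (ustar (x t z) (p t z))) (x t z) h) t)
    (hxT : ∀ z ∈ U, x T z = z)
    (hpT : ∀ z ∈ U, p T z = gradient ψ z)
    -- regularity: `x` and `p` are three times continuously differentiable
    (hxreg : ContDiffOn ℝ 3 (fun q : ℝ × E n => x q.1 q.2) (Set.Icc 0 T ×ˢ U))
    (hpreg : ContDiffOn ℝ 3 (fun q : ℝ × E n => p q.1 q.2) (Set.Icc 0 T ×ˢ U))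
    -- `z ↦ u(·,z)` is continuous into `L^∞([0,T]; ℝᵐ)` at `z̄`
    (hLinf : ∀ ε > (0 : ℝ), ∃ δ' > (0 : ℝ), ∀ z ∈ U, ‖z - zbar‖ < δ' →
        ∀ t ∈ Set.Icc (0 : ℝ) T,
          ‖ustar (x t z) (p t z) - ustar (x t zbar) (p t zbar)‖ ≤ ε)
    -- `u(·,z̄)` is a weak local minimizer for the initial point `x̄ = x(0,z̄)`
    (hweak : ∃ δ > (0 : ℝ), ∀ u' : ℝ → E m, ∀ x' : ℝ → E n,
        MeasureTheory.AEStronglyMeasurable u'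
          (MeasureTheory.volume.restrict (Set.Icc (0 : ℝ) T)) →
        (∀ t ∈ Set.Icc (0 : ℝ) T, ‖u' t - ustar (x t zbar) (p t zbar)‖ < δ) →
        ContinuousOn x' (Set.Icc (0 : ℝ) T) →
        (∀ t ∈ Set.Icc (0 : ℝ) T,
          x' t = x 0 zbar + ∫ s in (0 : ℝ)..t, f (x' s) (u' s)) →
        (∫ t in (0 : ℝ)..T, L (x t zbar) (ustar (x t zbar) (p t zbar)))
            + ψ (x T zbar)
          ≤ (∫ t in (0 : ℝ)..T, L (x' t) (u' t)) + ψ (x' T))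
    -- `v` is a unit vector with `x_z(0, z̄) v = 0`
    (v : E n) (hv : ‖v‖ = 1)
    (hker : fderiv ℝ (x 0) zbar v = 0) :
    ⟪fderiv ℝ (p 0) zbar v, iteratedFDeriv ℝ 2 (x 0) zbar ![v, v]⟫_ℝ = 0 := by
  obtain ⟨δ, hδ, hweak⟩ := hweak
  have hfC := f_contDiff f0 fi hf0 hfi f hfdef
  have hhC := ham_contDiff_s11 f L hfC hL
  have hhd : Differentiable ℝ (ham f L) := hhC.differentiable (by norm_num)
  have hhC2 : ContDiff ℝ 2 (ham f L) := hhC.of_le (by norm_num)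
  have hst : ∀ θ : E n × E n, ∀ c, fderiv ℝ (ham f L) (θ, ustar θ.1 θ.2) (0, c) = 0 :=
    fun θ c => ham_stat f L hhd θ.1 θ.2 _ (hustar θ.1 θ.2) c
  -- compact set
  obtain ⟨ρ, hρ, hρU⟩ := Metric.nhds_basis_closedBall.mem_iff.1 (hU.mem_nhds hzbar)
  have hKc : IsCompact (Set.Icc 0 T ×ˢ Metric.closedBall zbar ρ) :=
    isCompact_Icc.prod (isCompact_closedBall _ _)
  have hKv : Convex ℝ (Set.Icc 0 T ×ˢ Metric.closedBall zbar ρ) :=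
    (convex_Icc _ _).prod (convex_closedBall _ _)
  have hKs : Set.Icc 0 T ×ˢ Metric.closedBall zbar ρ ⊆ Set.Icc 0 T ×ˢ U :=
    Set.prod_mono_right hρU
  have hxr := hxreg.mono hKs
  have hpr := hpreg.mono hKs
  obtain ⟨Kx, hKx⟩ := hxr.exists_lipschitzOnWith (by norm_num) hKv hKc
  obtain ⟨Kp, hKp⟩ := hpr.exists_lipschitzOnWith (by norm_num) hKv hKc
  obtain ⟨Bx, hBx⟩ := hKc.exists_bound_of_continuousOn hxr.continuousOn
  obtain ⟨Bp, hBp⟩ := hKc.exists_bound_of_continuousOn hpr.continuousOn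
  set R0 := max Bx Bp with hR0
  obtain ⟨⟨M, hM⟩, Cu, hCu0, hCu⟩ := ustar_reg (ham f L) hhC2 δL hδL
    (ham_mono f0 fi f hfdef L hL hhd δL hconv) (fun θ => ustar θ.1 θ.2) hst R0
  set R := max (R0 + 2) M with hR
  obtain ⟨C, hC, hTh⟩ := uniform_taylor (ham f L) hhC2 R
  obtain ⟨Cψ, hCψ, hTψ⟩ := uniform_taylor ψ (hψ.of_le (by norm_num)) R
  obtain ⟨Kf, hKf⟩ : ∃ K, LipschitzOnWith K (fun q : E n × E m => f q.1 q.2)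
      (Metric.closedBall 0 R) :=
    hfC.contDiffOn.exists_lipschitzOnWith (by norm_num) (convex_closedBall _ _)
      (isCompact_closedBall _ _)
  -- basic facts about the family
  have hxB : ∀ z ∈ Metric.closedBall zbar ρ, ∀ t ∈ Set.Icc 0 T, ‖x t z‖ ≤ R0 :=
    fun z hz t ht => (hBx (t, z) ⟨ht, hz⟩).trans (le_max_left _ _)
  have hpB : ∀ z ∈ Metric.closedBall zbar ρ, ∀ t ∈ Set.Icc 0 T, ‖p t z‖ ≤ R0 :=
    fun z hz t ht => (hBp (t, z) ⟨ht, hz⟩).trans (le_max_right _ _)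
  have hθB : ∀ z ∈ Metric.closedBall zbar ρ, ∀ t ∈ Set.Icc 0 T,
      (x t z, p t z) ∈ Metric.closedBall (0 : E n × E n) R0 := fun z hz t ht => by
    rw [mem_closedBall_zero_iff, Prod.norm_def]
    exact max_le (hxB z hz t ht) (hpB z hz t ht)
  have hR0R : R0 + 2 ≤ R := le_max_left _ _
  have huB : ∀ z ∈ Metric.closedBall zbar ρ, ∀ t ∈ Set.Icc 0 T,
      ‖ustar (x t z) (p t z)‖ ≤ R :=
    fun z hz t ht => (hM _ (hθB z hz t ht)).trans (le_max_right _ _)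
  have huC : ∀ z ∈ Metric.closedBall zbar ρ,
      ContinuousOn (fun t => ustar (x t z) (p t z)) (Set.Icc 0 T) := fun z hz => by
    have h1 : ContinuousOn (fun θ : E n × E n => ustar θ.1 θ.2) (Metric.closedBall 0 R0) := by
      refine (LipschitzOnWith.of_dist_le_mul (K := ⟨Cu, hCu0⟩) fun a ha b hb => ?_).continuousOn
      rw [dist_eq_norm, dist_eq_norm]; exact hCu a ha b hb
    have h2 : ContinuousOn (fun t : ℝ => (t, z)) (Set.Icc 0 T) := by fun_prop
    have h3 : Set.MapsTo (fun t : ℝ => (t, z)) (Set.Icc 0 T)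
      (Set.Icc 0 T ×ˢ Metric.closedBall zbar ρ) := fun t ht => ⟨ht, hz⟩
    have h4 : ContinuousOn (fun t : ℝ => (x t z, p t z)) (Set.Icc 0 T) :=
      (hxr.continuousOn.comp h2 h3).prodMk (hpr.continuousOn.comp h2 h3)
    exact h1.comp h4 (fun t ht => hθB z hz t ht)
  have hpode' : ∀ z ∈ Metric.closedBall zbar ρ, ∀ t ∈ Set.Icc 0 T, ∀ k : E n,
      HasDerivAt (fun s => ⟪p s z, k⟫_ℝ)
        (- fderiv ℝ (ham f L) ((x t z, p t z), ustar (x t z) (p t z)) ((k, 0), 0)) t :=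
    fun z hz t ht k => (hpode z (hρU hz) t ht k).congr_deriv (by
      rw [ham_x f L hfC hL]; ring)
  have hKEY : ∀ z ∈ Metric.closedBall zbar ρ, ∀ (y : ℝ → E n) (w : ℝ → E m),
      ContinuousOn w (Set.Icc 0 T) →
      (∀ t ∈ Set.Icc 0 T, HasDerivWithinAt y (f (y t) (w t)) (Set.Icc 0 T) t) →
      (∀ t ∈ Set.Icc 0 T, ‖y t‖ ≤ R) → (∀ t ∈ Set.Icc 0 T, ‖w t‖ ≤ R) →
      ∀ d : ℝ, (∀ t ∈ Set.Icc 0 T, ‖y t - x t z‖ ≤ d) →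
      (∀ t ∈ Set.Icc 0 T, ‖w t - ustar (x t z) (p t z)‖ ≤ d) →
      |((∫ t in (0:ℝ)..T, L (y t) (w t)) + ψ (y T))
        - ((∫ t in (0:ℝ)..T, L (x t z) (ustar (x t z) (p t z))) + ψ (x T z))
        - ⟪p 0 z, y 0 - x 0 z⟫_ℝ| ≤ (C * T + Cψ) * d ^ 2 := by
    intro z hz y w hw hy hyR hwR d hyd hwd
    refine key_estimate T hT f L hL.continuous (ham f L) (fun _ _ _ => rfl) ψ R C Cψ hC hTh hTψ hCψ
      (fun t => x t z) (fun t => p t z) (fun t => ustar (x t z) (p t z)) (huC z hz)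
      (fun t ht => hxode z (hρU hz) t ht) (hpode' z hz) (fun t ht c => hst (x t z, p t z) c)
      (fun k => ?_) y w hw hy (fun t ht => (hxB z hz t ht).trans (by linarith))
      (fun t ht => (hpB z hz t ht).trans (by linarith)) (huB z hz) hyR hwR d hyd hwd
    rw [hpT z (hρU hz), hxT z (hρU hz), inner_gradient_left]
  -- the one-parameter family
  set zz : ℝ → E n := fun s => zbar + s • v with hzz
  have hzd : ∀ a b, ‖zz b - zz a‖ = |b - a| := fun a b => by
    simp only [hzz, add_sub_add_left_eq_sub, ← sub_smul, norm_smul, hv, mul_one, Real.norm_eq_abs]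
  have hzm : ∀ s, |s| ≤ ρ → zz s ∈ Metric.closedBall zbar ρ := fun s hs => by
    rw [mem_closedBall_iff_norm]
    simpa [hzz, norm_smul, hv] using hs
  have hz0 : zz 0 = zbar := by simp [hzz]
  have hLipx : ∀ a b, |a| ≤ ρ → |b| ≤ ρ → ∀ t ∈ Set.Icc 0 T,
      ‖x t (zz b) - x t (zz a)‖ ≤ Kx * |b - a| := fun a b ha hb t ht => by
    have := hKx.norm_sub_le (x := (t, zz b)) (y := (t, zz a)) ⟨ht, hzm b hb⟩ ⟨ht, hzm a ha⟩
    simpa [Prod.norm_def, hzd] using this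
  have hLipp : ∀ a b, |a| ≤ ρ → |b| ≤ ρ → ∀ t ∈ Set.Icc 0 T,
      ‖p t (zz b) - p t (zz a)‖ ≤ Kp * |b - a| := fun a b ha hb t ht => by
    have := hKp.norm_sub_le (x := (t, zz b)) (y := (t, zz a)) ⟨ht, hzm b hb⟩ ⟨ht, hzm a ha⟩
    simpa [Prod.norm_def, hzd] using this
  set K1 : ℝ := Kx + Kp with hK1
  have hKx0 : (0:ℝ) ≤ Kx := Kx.2
  have hKp0 : (0:ℝ) ≤ Kp := Kp.2
  have hLipu : ∀ a b, |a| ≤ ρ → |b| ≤ ρ → ∀ t ∈ Set.Icc 0 T,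
      ‖ustar (x t (zz b)) (p t (zz b)) - ustar (x t (zz a)) (p t (zz a))‖
        ≤ Cu * (K1 * |b - a|) := fun a b ha hb t ht => by
    refine (hCu _ (hθB _ (hzm b hb) t ht) _ (hθB _ (hzm a ha) t ht)).trans ?_
    gcongr
    rw [Prod.mk_sub_mk, Prod.norm_def]
    have h1 := hLipx a b ha hb t ht
    have h2 := hLipp a b ha hb t ht
    have h3 := abs_nonneg (b - a)
    exact max_le (h1.trans (by gcongr; linarith)) (h2.trans (by gcongr; linarith))
  set Φ : ℝ → ℝ := fun s => (∫ t in (0:ℝ)..T,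
    L (x t (zz s)) (ustar (x t (zz s)) (p t (zz s)))) + ψ (x T (zz s)) with hΦdef
  set C1 : ℝ := (C * T + Cψ) * ((1 + Cu) * K1) ^ 2 with hC1
  have hquad : ∀ a b, |a| ≤ ρ → |b| ≤ ρ →
      |Φ b - Φ a - ⟪p 0 (zz a), x 0 (zz b) - x 0 (zz a)⟫_ℝ| ≤ C1 * (b - a) ^ 2 := by
    intro a b ha hb
    have h3 := abs_nonneg (b - a)
    have hK10 : 0 ≤ K1 := by positivity
    have := hKEY (zz a) (hzm a ha) (fun t => x t (zz b)) (fun t => ustar (x t (zz b)) (p t (zz b)))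
      (huC _ (hzm b hb)) (fun t ht => (hxode _ (hρU (hzm b hb)) t ht).hasDerivWithinAt)
      (fun t ht => (hxB _ (hzm b hb) t ht).trans (by linarith)) (huB _ (hzm b hb))
      ((1 + Cu) * K1 * |b - a|)
      (fun t ht => (hLipx a b ha hb t ht).trans (by
        gcongr
        nlinarith [mul_nonneg hCu0 hK10]))
      (fun t ht => (hLipu a b ha hb t ht).trans (by
        rw [← mul_assoc]; gcongr; linarith))
    refine this.trans (le_of_eq ?_)
    rw [mul_pow, sq_abs, hC1]; ring
  -- smoothness at time zero
  have h0m : (0:ℝ) ∈ Set.Icc 0 T := Set.left_mem_Icc.2 hT.le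
  have hTm : T ∈ Set.Icc 0 T := Set.right_mem_Icc.2 hT.le
  have hinc : ContDiff ℝ 3 (fun z : E n => ((0:ℝ), z)) := contDiff_const.prodMk contDiff_id
  have hx0 : ContDiffOn ℝ 3 (x 0) U := hxreg.comp hinc.contDiffOn (fun z hz => ⟨h0m, hz⟩)
  have hp0 : ContDiffOn ℝ 3 (p 0) U := hpreg.comp hinc.contDiffOn (fun z hz => ⟨h0m, hz⟩)
  have hx0a : ∀ z ∈ U, ContDiffAt ℝ 3 (x 0) z := fun z hz => hx0.contDiffAt (hU.mem_nhds hz)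
  have hp0a : ∀ z ∈ U, ContDiffAt ℝ 3 (p 0) z := fun z hz => hp0.contDiffAt (hU.mem_nhds hz)
  have hXd : ∀ s, |s| ≤ ρ → HasDerivAt (fun s => x 0 (zz s)) (fderiv ℝ (x 0) (zz s) v) s :=
    fun s hs => line_deriv (x 0) zbar v s ((hx0a _ (hρU (hzm s hs))).differentiableAt (by norm_num))
  have hPd : ∀ s, |s| ≤ ρ → HasDerivAt (fun s => p 0 (zz s)) (fderiv ℝ (p 0) (zz s) v) s :=
    fun s hs => line_deriv (p 0) zbar v s ((hp0a _ (hρU (hzm s hs))).differentiableAt (by norm_num))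
  have hx02 : ContDiffAt ℝ 2 (fderiv ℝ (x 0)) (zbar + (0:ℝ) • v) :=
    (hx0a _ (by simpa using hzbar)).fderiv_right (by norm_num)
  have hp02 : ContDiffAt ℝ 2 (fderiv ℝ (p 0)) (zbar + (0:ℝ) • v) :=
    (hp0a _ (by simpa using hzbar)).fderiv_right (by norm_num)
  set X2 : E n := fderiv ℝ (fderiv ℝ (x 0)) zbar v v with hX2def
  have hX2 : HasDerivAt (fun s => fderiv ℝ (x 0) (zz s) v) X2 0 := by
    have h1 := (line_deriv (fderiv ℝ (x 0)) zbar v 0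
      (hx02.differentiableAt (by norm_num))).clm_apply (hasDerivAt_const (0:ℝ) v)
    refine h1.congr_deriv ?_
    simp [hX2def]
  have hP'c : ContinuousAt (fun s => fderiv ℝ (p 0) (zz s) v) 0 :=
    ((line_deriv (fderiv ℝ (p 0)) zbar v 0
      (hp02.differentiableAt (by norm_num))).clm_apply (hasDerivAt_const (0:ℝ) v)).continuousAt
  have hev : ∀ᶠ r in nhds (0:ℝ), |r| < ρ := by
    refine Metric.eventually_nhds_iff_ball.2 ⟨ρ, hρ, fun r hr => by simpa using hr⟩
  have hXe : ∀ᶠ r in nhds (0:ℝ), HasDerivAt (fun s => x 0 (zz s)) (fderiv ℝ (x 0) (zz r) v) r :=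
    hev.mono fun r hr => hXd r hr.le
  have hker0 : fderiv ℝ (x 0) (zz 0) v = 0 := by rw [hz0]; exact hker
  have hΦd : ∀ a, |a| < ρ → HasDerivAt Φ ⟪p 0 (zz a), fderiv ℝ (x 0) (zz a) v⟫_ℝ a := by
    intro a ha
    have e1 : HasDerivAt (fun b => ⟪p 0 (zz a), x 0 (zz b)⟫_ℝ)
        ⟪p 0 (zz a), fderiv ℝ (x 0) (zz a) v⟫_ℝ a := by
      simpa using (hasDerivAt_const a (p 0 (zz a))).inner ℝ (hXd a ha.le)
    have e2 : HasDerivAt (fun b => Φ b - Φ a - ⟪p 0 (zz a), x 0 (zz b) - x 0 (zz a)⟫_ℝ) 0 a := by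
      rw [hasDerivAt_iff_hasFDerivAt]
      have hO : (fun b => Φ b - Φ a - ⟪p 0 (zz a), x 0 (zz b) - x 0 (zz a)⟫_ℝ)
          =O[nhds a] fun b => ‖b - a‖ ^ 2 := by
        refine Asymptotics.IsBigO.of_bound C1 ?_
        have : ∀ᶠ b in nhds a, |b| < ρ :=
          continuous_abs.continuousAt.eventually_lt continuousAt_const ha
        filter_upwards [this] with b hb
        have := hquad a b ha.le hb.le
        simpa using this
      simpa using hO.hasFDerivAt (by norm_num)
    have e3 := (e2.fun_add e1).add_const (Φ a - ⟪p 0 (zz a), x 0 (zz a)⟫_ℝ)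
    rw [zero_add] at e3
    refine e3.congr_of_eventuallyEq (Filter.Eventually.of_forall fun b => ?_)
    simp only [inner_sub_right]; ring
  -- the comparison trajectories
  set e : ℝ := Real.exp (Kf * T) with he
  have he0 : 0 < e := Real.exp_pos _
  set CX : ℝ := ‖X2‖ / 2 + 1 with hCX
  have hCX0 : 0 < CX := by positivity
  have hXq : ∀ᶠ r in nhds (0:ℝ), ‖x 0 (zz 0) - x 0 (zz r)‖ ≤ CX * r ^ 2 := by
    have := second_taylor (fun s => x 0 (zz s)) (fun s => fderiv ℝ (x 0) (zz s) v) X2 hXe hker0 hX2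
      1 one_pos
    filter_upwards [this] with r hr
    rw [norm_sub_rev]
    have h1 := norm_le_norm_add_norm_sub' (x 0 (zz r) - x 0 (zz 0)) ((r^2/2) • X2)
    have h2 : ‖(r^2/2) • X2‖ = r^2/2 * ‖X2‖ := by
      rw [norm_smul, Real.norm_of_nonneg (by positivity)]
    rw [h2] at h1
    rw [sq_abs] at hr
    rw [hCX]; nlinarith
  have hsmall : ∀ᶠ r in nhds (0:ℝ), CX * r ^ 2 * e < 1 := by
    have : ContinuousAt (fun r : ℝ => CX * r ^ 2 * e) 0 := by fun_prop
    exact this.eventually_lt continuousAt_const (by simp)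
  obtain ⟨δ', hδ', hLinf⟩ := hLinf (δ / 2) (by positivity)
  have hev2 : ∀ᶠ r in nhds (0:ℝ), |r| < δ' :=
    Metric.eventually_nhds_iff_ball.2 ⟨δ', hδ', fun r hr => by simpa using hr⟩
  have hpos : ∀ᶠ r in nhds (0:ℝ), 0 ≤ Φ r - Φ 0 + ⟪p 0 (zz r), x 0 (zz 0) - x 0 (zz r)⟫_ℝ
      + ((C * T + Cψ) * (CX * e) ^ 2) * r ^ 4 := by
    filter_upwards [hev, hev2, hXq, hsmall] with r hr hr2 hrX hrs
    have hzr := hzm r hr.le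
    set u : ℝ → E m := fun t => ustar (x t (zz r)) (p t (zz r)) with hu
    set η0 : E n := x 0 (zz 0) - x 0 (zz r) with hη0
    have hη0e : ‖η0‖ * e ≤ CX * r ^ 2 * e := by gcongr
    have hxc : ContinuousOn (fun t => x t (zz r)) (Set.Icc 0 T) := fun t ht =>
      (hxode _ (hρU hzr) t ht).continuousAt.continuousWithinAt
    have hxu : ∀ t ∈ Set.Icc 0 T, ∀ η ∈ Metric.closedBall (0 : E n) 2,
        (x t (zz r) + η, u t) ∈ Metric.closedBall (0 : E n × E m) R := fun t ht η hη => by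
      rw [mem_closedBall_zero_iff] at hη ⊢
      rw [Prod.norm_def]
      refine max_le ?_ (huB _ hzr t ht)
      have := norm_add_le (x t (zz r)) η
      have := hxB _ hzr t ht
      simp only
      linarith
    obtain ⟨η, hηi, hηd, hηb⟩ := ode_exists T hT Kf
      (fun t η => f (x t (zz r) + η) (u t) - f (x t (zz r)) (u t))
      (fun η => by
        refine ContinuousOn.sub ?_ ?_
        · exact hfC.continuous.comp_continuousOn ((hxc.add continuousOn_const).prodMk (huC _ hzr))
        · exact hfC.continuous.comp_continuousOn (hxc.prodMk (huC _ hzr)))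
      (fun t ht => LipschitzOnWith.of_dist_le_mul fun a ha b hb => by
        have := hKf.dist_le_mul _ (hxu t ht a ha) _ (hxu t ht b hb)
        simpa [Prod.dist_eq] using this)
      (fun t ht => by simp) η0 (hη0e.trans hrs.le)
    set y : ℝ → E n := fun t => x t (zz r) + η t with hy
    have hyd : ∀ t ∈ Set.Icc 0 T, HasDerivWithinAt y (f (y t) (u t)) (Set.Icc 0 T) t :=
      fun t ht => ((hxode _ (hρU hzr) t ht).hasDerivWithinAt.fun_add (hηd t ht)).congr_deriv (by
        simp [hy, hu])
    have hyc : ContinuousOn y (Set.Icc 0 T) := fun t ht => (hyd t ht).continuousWithinAt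
    have hη1 : ∀ t ∈ Set.Icc 0 T, ‖η t‖ ≤ 1 := fun t ht => (hηb t ht).trans (hη0e.trans hrs.le)
    have hy0 : y 0 = x 0 (zz 0) := by simp [hy, hηi, hη0]
    have hk := hKEY (zz r) hzr y u (huC _ hzr) hyd
      (fun t ht => by
        have := hxu t ht (η t) (by rw [mem_closedBall_zero_iff]; linarith [hη1 t ht])
        rw [mem_closedBall_zero_iff] at this
        exact (norm_fst_le _).trans this) (huB _ hzr) (CX * r ^ 2 * e)
      (fun t ht => by simpa [hy] using (hηb t ht).trans hη0e)
      (fun t ht => by simp [hu]; positivity)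
    have hw := hweak u y ((huC _ hzr).aestronglyMeasurable measurableSet_Icc)
      (fun t ht => (hLinf _ (hρU hzr) (by simpa [hzz, norm_smul, hv] using hr2) t ht).trans_lt
        (by linarith)) hyc (fun t ht => by
        have hsub : Set.Icc 0 t ⊆ Set.Icc 0 T := Set.Icc_subset_Icc_right ht.2
        have hfc : ContinuousOn (fun s => f (y s) (u s)) (Set.Icc 0 t) :=
          (hfC.continuous.comp_continuousOn (hyc.prodMk (huC _ hzr))).mono hsub
        rw [intervalIntegral.integral_eq_sub_of_hasDerivAt_of_le ht.1 (hyc.mono hsub)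
          (fun s hs => (hyd s ⟨hs.1.le, hs.2.le.trans ht.2⟩).hasDerivAt
            (Icc_mem_nhds hs.1 (hs.2.trans_le ht.2)))
          (ContinuousOn.intervalIntegrable (by rwa [Set.uIcc_of_le ht.1])), hy0, hz0]
        abel)
    rw [hy0] at hk
    have hk2 := (abs_le.1 hk).2
    have hw' : Φ 0 ≤ (∫ t in (0 : ℝ)..T, L (y t) (u t)) + ψ (y T) := by
      simp only [hΦdef, hz0]; exact hw
    have hΦr : Φ r = (∫ t in (0:ℝ)..T,
      L (x t (zz r)) (ustar (x t (zz r)) (p t (zz r)))) + ψ (x T (zz r)) := rfl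
    rw [← hΦr] at hk2
    have hid : (C * T + Cψ) * (CX * r ^ 2 * e) ^ 2 = ((C * T + Cψ) * (CX * e) ^ 2) * r ^ 4 := by
      ring
    rw [hid] at hk2
    linarith
  have hfin := final_analysis (fun s => x 0 (zz s)) (fun s => fderiv ℝ (x 0) (zz s) v)
    (fun s => p 0 (zz s)) (fun s => fderiv ℝ (p 0) (zz s) v) X2 Φ _ hXe
    (hev.mono fun r hr => hPd r hr.le) hker0 hX2 hP'c (hev.mono fun r hr => hΦd r hr) hpos
  simp only [hz0] at hfin
  rw [iteratedFDeriv_two_apply]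
  simpa [hX2def] using hfin
end
end
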